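/- arXiv:2001.00490 — 2 statements merged into one kernel-verified Lean document; each statement's English description precedes it below -/
import Mathlib

section
/- Let α ∈ (0,1) and let u : ℝ² → ℝ satisfy [u]_α := sup_{x≠y} |u(x) − u(y)| / d(x,y)^α < ∞, where d is the parabolic distance. Then for all integers i, j ≥ 0 with i + j ≥ 1 there is a constant C(α, i, j) such that for all T > 0 and x ∈ ℝ², |∂₁^i ∂₂^j (u * ψ_T)(x)| ≤ C(α, i, j) · [u]_α · T^{(α − i − 2j)/4}. -/
open MeasureTheory

/-- The parabolic distance on `ℝ²`. -/
noncomputable def pdist (x y : ℝ × ℝ) : ℝ := |x.1 - y.1| + Real.sqrt |x.2 - y.2|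

/-- Partial derivative in the first (space-like) variable. -/
noncomputable def pd1 (f : ℝ × ℝ → ℝ) : ℝ × ℝ → ℝ := fun x => deriv (fun s => f (s, x.2)) x.1

/-- Partial derivative in the second (time-like) variable. -/
noncomputable def pd2 (f : ℝ × ℝ → ℝ) : ℝ × ℝ → ℝ := fun x => deriv (fun s => f (x.1, s)) x.2

def IsPsiKernel (ψ : ℝ → ℝ × ℝ → ℝ) : Prop :=
  (∀ T : ℝ, 0 < T → ∃ φ : SchwartzMap (ℝ × ℝ) ℝ, ψ T = ⇑φ) ∧
  (∃ C : ℝ, ∀ T : ℝ, 0 < T → ∀ k : ℝ × ℝ,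
      (∫ x : ℝ × ℝ,
          Complex.exp (-(2 * Real.pi * (k.1 * x.1 + k.2 * x.2) : ℝ) * Complex.I) * (ψ T x : ℂ))
        = (C : ℂ) * Complex.exp ((-(T * (k.1 ^ 4 + k.2 ^ 2)) : ℝ) : ℂ)) ∧
  (∫ x : ℝ × ℝ, |ψ 1 x|) = 1

open scoped SchwartzMap LineDeriv FourierTransform

lemma pdist_nonneg (x y : ℝ × ℝ) : 0 ≤ pdist x y := by unfold pdist; positivity

lemma pdist_sub_zero (x y : ℝ × ℝ) : pdist (x - y) 0 = pdist x y := by simp [pdist]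

/-- Powers of the parabolic distance grow at most linearly. -/
lemma pdist_rpow_le {α : ℝ} (hα : 0 < α) (hα1 : α < 1) (w : ℝ × ℝ) :
    pdist w 0 ^ α ≤ 3 * (1 + ‖w‖) := by
  have h1 : |w.1| ≤ ‖w‖ := norm_fst_le w
  have h2 : |w.2| ≤ ‖w‖ := norm_snd_le w
  have h3 : √|w.2| ≤ 1 + |w.2| := by
    rw [Real.sqrt_le_left (by positivity)]
    nlinarith [abs_nonneg w.2]
  have h4 : pdist w 0 ≤ 2 * (1 + ‖w‖) := by
    simp only [pdist, Prod.fst_zero, Prod.snd_zero, sub_zero]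
    linarith
  have h5 : pdist w 0 ^ α ≤ 1 + pdist w 0 := by
    rcases le_total (pdist w 0) 1 with h | h
    · linarith [Real.rpow_le_one (pdist_nonneg w 0) h hα.le, pdist_nonneg w 0]
    · have h6 := Real.rpow_le_rpow_of_exponent_le h hα1.le
      rw [Real.rpow_one] at h6
      linarith
  linarith [norm_nonneg w]

lemma continuous_pdist_rpow {α : ℝ} (hα : 0 < α) (x : ℝ × ℝ) :
    Continuous fun y => pdist x y ^ α := by
  have : Continuous fun y => pdist x y := by unfold pdist; fun_prop
  exact this.rpow_const fun _ => Or.inr hα.le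

/-- Continuous functions of at most linear growth. -/
def HasLinearGrowth (u : ℝ × ℝ → ℝ) : Prop :=
  Continuous u ∧ ∃ K : ℝ, ∀ y, |u y| ≤ K * (1 + ‖y‖)

lemma hasLinearGrowth_const (c : ℝ) : HasLinearGrowth fun _ => c :=
  ⟨continuous_const, |c|, fun y => le_mul_of_one_le_right (abs_nonneg c) (by simp)⟩

lemma hasLinearGrowth_pdist_rpow {α : ℝ} (hα : 0 < α) (hα1 : α < 1) :
    HasLinearGrowth fun y => pdist y 0 ^ α := by
  refine ⟨?_, 3, fun y => ?_⟩
  · have : Continuous fun y => pdist y 0 := by unfold pdist; fun_prop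
    exact this.rpow_const fun _ => Or.inr hα.le
  · rw [abs_of_nonneg (Real.rpow_nonneg (pdist_nonneg y 0) α)]
    exact pdist_rpow_le hα hα1 y

lemma nonneg_of_parabolic_holder {α A : ℝ} {u : ℝ × ℝ → ℝ}
    (hu : ∀ x y : ℝ × ℝ, |u x - u y| ≤ A * pdist x y ^ α) : 0 ≤ A := by
  have h := (abs_nonneg _).trans (hu (1, 0) 0)
  simpa [pdist] using h

lemma hasLinearGrowth_of_parabolic_holder {α A : ℝ} (hα : 0 < α) (hα1 : α < 1)
    {u : ℝ × ℝ → ℝ} (hu : ∀ x y : ℝ × ℝ, |u x - u y| ≤ A * pdist x y ^ α) :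
    HasLinearGrowth u := by
  have hA := nonneg_of_parabolic_holder hu
  refine ⟨continuous_iff_continuousAt.2 fun x => ?_, |u 0| + 3 * A, fun y => ?_⟩
  · have h : Filter.Tendsto (fun y => A * pdist x y ^ α) (nhds x) (nhds 0) := by
      have := ((continuous_pdist_rpow hα x).const_mul A).tendsto x
      simpa [pdist, Real.zero_rpow hα.ne'] using this
    refine tendsto_iff_norm_sub_tendsto_zero.2 (squeeze_zero (fun _ => norm_nonneg _)
      (fun y => ?_) h)
    rw [norm_sub_rev]
    exact hu x y
  · have h1 := hu y 0
    have h2 := mul_le_mul_of_nonneg_left (pdist_rpow_le hα hα1 y) hA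
    have h3 : |u y| ≤ |u y - u 0| + |u 0| := by
      simpa using abs_add_le (u y - u 0) (u 0)
    nlinarith [norm_nonneg y, mul_nonneg (abs_nonneg (u 0)) (norm_nonneg y)]

lemma SchwartzMap.exists_translate_bound (φ : 𝓢(ℝ × ℝ, ℝ)) :
    ∃ M : ℝ, 0 ≤ M ∧ ∀ z y, (1 + ‖y‖) ^ 4 * |φ (z - y)| ≤ M * (1 + ‖z‖) ^ 4 := by
  obtain ⟨M, hM⟩ : ∃ M : ℝ, ∀ w, (1 + ‖w‖) ^ 4 * |φ w| ≤ M := by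
    refine ⟨2 ^ 4 * (Finset.Iic (4, 0)).sup (fun m => SchwartzMap.seminorm ℝ m.1 m.2) φ,
      fun w => ?_⟩
    have h := SchwartzMap.one_add_le_sup_seminorm_apply (𝕜 := ℝ) (m := (4, 0)) (k := 4) (n := 0)
      le_rfl le_rfl φ w
    rwa [norm_iteratedFDeriv_zero, Real.norm_eq_abs] at h
  have hM0 : 0 ≤ M := le_trans (by positivity) (hM 0)
  refine ⟨M, hM0, fun z y => ?_⟩
  have h1 : 1 + ‖y‖ ≤ (1 + ‖z‖) * (1 + ‖z - y‖) := by
    have : ‖y‖ ≤ ‖z‖ + ‖z - y‖ := by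
      simpa using norm_sub_le z (z - y)
    nlinarith [norm_nonneg z, norm_nonneg (z - y), mul_nonneg (norm_nonneg z) (norm_nonneg (z - y))]
  calc (1 + ‖y‖) ^ 4 * |φ (z - y)|
      ≤ ((1 + ‖z‖) * (1 + ‖z - y‖)) ^ 4 * |φ (z - y)| := by gcongr
    _ = (1 + ‖z‖) ^ 4 * ((1 + ‖z - y‖) ^ 4 * |φ (z - y)|) := by ring
    _ ≤ (1 + ‖z‖) ^ 4 * M := by gcongr; exact hM _
    _ = M * (1 + ‖z‖) ^ 4 := mul_comm _ _

/-- Locally uniform integrable domination of the integrand of a convolution with a Schwartz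
function. -/
lemma HasLinearGrowth.exists_integrable_bound {u : ℝ × ℝ → ℝ} (hu : HasLinearGrowth u)
    (φ : 𝓢(ℝ × ℝ, ℝ)) (R : ℝ) :
    ∃ g : ℝ × ℝ → ℝ, Integrable g ∧ ∀ z, ‖z‖ ≤ R → ∀ y, ‖u y * φ (z - y)‖ ≤ g y := by
  obtain ⟨-, K, hK⟩ := hu
  obtain ⟨M, hM0, hM⟩ := φ.exists_translate_bound
  have hK0 : 0 ≤ K := by simpa using (abs_nonneg _).trans (hK 0)
  refine ⟨fun y => K * (M * (1 + R) ^ 4) * (1 + ‖y‖) ^ (-3 : ℝ),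
    (integrable_one_add_norm (by norm_num)).const_mul _, fun z hz y => ?_⟩
  have hy : 0 < 1 + ‖y‖ := by positivity
  beta_reduce
  rw [Real.rpow_neg hy.le, ← div_eq_mul_inv, le_div_iff₀ (by positivity), norm_mul,
    Real.norm_eq_abs, Real.norm_eq_abs]
  norm_cast
  calc |u y| * |φ (z - y)| * (1 + ‖y‖) ^ 3
      ≤ K * (1 + ‖y‖) * |φ (z - y)| * (1 + ‖y‖) ^ 3 := by gcongr; exact hK y
    _ = K * ((1 + ‖y‖) ^ 4 * |φ (z - y)|) := by ring
    _ ≤ K * (M * (1 + ‖z‖) ^ 4) := mul_le_mul_of_nonneg_left (hM z y) hK0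
    _ ≤ K * (M * (1 + R) ^ 4) := by gcongr

lemma HasLinearGrowth.integrable_mul_translate {u : ℝ × ℝ → ℝ} (hu : HasLinearGrowth u)
    (φ : 𝓢(ℝ × ℝ, ℝ)) (z : ℝ × ℝ) : Integrable fun y => u y * φ (z - y) := by
  obtain ⟨g, hg, h⟩ := hu.exists_integrable_bound φ ‖z‖
  have := hu.1
  have := φ.continuous
  exact hg.mono' (by fun_prop) (.of_forall (h z le_rfl))

lemma HasLinearGrowth.lineDeriv_conv {u : ℝ × ℝ → ℝ} (hu : HasLinearGrowth u)
    (φ : 𝓢(ℝ × ℝ, ℝ)) (z v : ℝ × ℝ) :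
    lineDeriv ℝ (fun z => ∫ y, u y * φ (z - y)) z v = ∫ y, u y * (∂_{v} φ) (z - y) := by
  obtain ⟨g, hg, h⟩ := hu.exists_integrable_bound (∂_{v} φ) (‖z‖ + ‖v‖)
  have hc := hu.1
  have hφ := φ.continuous
  have hφ' := (∂_{v} φ).continuous
  have key := hasDerivAt_integral_of_dominated_loc_of_deriv_le (μ := volume) (𝕜 := ℝ)
    (F := fun t y => u y * φ (z + t • v - y)) (F' := fun t y => u y * (∂_{v} φ) (z + t • v - y))
    (x₀ := 0) (bound := g) (Metric.ball_mem_nhds 0 one_pos)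
    (.of_forall fun t => by fun_prop) (hu.integrable_mul_translate φ _) (by fun_prop)
    (.of_forall fun y t ht => h _ ?_ y) hg (.of_forall fun y t ht => ?_)
  · simpa [lineDeriv] using key.2.deriv
  · have ht' : ‖t‖ ≤ 1 := by simpa using (Metric.mem_ball.1 ht).le
    refine (norm_add_le _ _).trans (add_le_add_right ?_ _)
    rw [norm_smul]
    exact mul_le_of_le_one_left (norm_nonneg v) ht'
  · refine HasDerivAt.const_mul _ ?_
    rw [SchwartzMap.lineDerivOp_apply_eq_fderiv]
    have h1 : HasDerivAt (fun t : ℝ => z + t • v - y) v t := by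
      simpa using (((hasDerivAt_id t).smul_const v).const_add z).sub_const y
    exact φ.differentiableAt.hasFDerivAt.comp_hasDerivAt t h1

lemma pd1_eq_lineDeriv (f : ℝ × ℝ → ℝ) (x : ℝ × ℝ) : pd1 f x = lineDeriv ℝ f x (1, 0) := by
  have := deriv_comp_const_add (fun s => f (s, x.2)) x.1 0
  simpa [pd1, lineDeriv, Prod.add_def] using this.symm

lemma pd2_eq_lineDeriv (f : ℝ × ℝ → ℝ) (x : ℝ × ℝ) : pd2 f x = lineDeriv ℝ f x (0, 1) := by
  have := deriv_comp_const_add (fun s => f (x.1, s)) x.2 0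
  simpa [pd2, lineDeriv, Prod.add_def] using this.symm

/-- Mixed derivatives of a convolution fall on the Schwartz factor. -/
lemma HasLinearGrowth.iterate_pd_conv {u : ℝ × ℝ → ℝ} (hu : HasLinearGrowth u)
    (φ : 𝓢(ℝ × ℝ, ℝ)) (i j : ℕ) :
    pd1^[i] (pd2^[j] fun z => ∫ y, u y * φ (z - y)) =
      fun z => ∫ y, u y *
        ((fun f : 𝓢(ℝ × ℝ, ℝ) => ∂_{((1, 0) : ℝ × ℝ)} f)^[i]
          ((fun f : 𝓢(ℝ × ℝ, ℝ) => ∂_{((0, 1) : ℝ × ℝ)} f)^[j] φ)) (z - y) := by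
  have h2 : ∀ φ : 𝓢(ℝ × ℝ, ℝ), pd2^[j] (fun z => ∫ y, u y * φ (z - y)) =
      fun z => ∫ y, u y * ((fun f : 𝓢(ℝ × ℝ, ℝ) => ∂_{((0, 1) : ℝ × ℝ)} f)^[j] φ) (z - y) := by
    induction j with
    | zero => intro φ; rfl
    | succ j ih =>
      intro φ
      rw [Function.iterate_succ_apply, Function.iterate_succ_apply, ← ih]
      congr 1
      ext z
      rw [pd2_eq_lineDeriv, hu.lineDeriv_conv]
  rw [h2]
  generalize (fun f : 𝓢(ℝ × ℝ, ℝ) => ∂_{((0, 1) : ℝ × ℝ)} f)^[j] φ = φ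
  induction i generalizing φ with
  | zero => rfl
  | succ i ih =>
    rw [Function.iterate_succ_apply, Function.iterate_succ_apply, ← ih]
    congr 1
    ext z
    rw [pd1_eq_lineDeriv, hu.lineDeriv_conv]

lemma iterate_pd_const {i j : ℕ} (hij : 1 ≤ i + j) (c : ℝ) :
    pd1^[i] (pd2^[j] fun _ => c) = fun _ => 0 := by
  have h1 : ∀ c : ℝ, pd1 (fun _ => c) = fun _ => 0 := fun c => by ext; simp [pd1]
  have h2 : ∀ c : ℝ, pd2 (fun _ => c) = fun _ => 0 := fun c => by ext; simp [pd2]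
  have h1' : ∀ n, pd1^[n] (fun _ => 0) = fun _ => 0 := fun n => Function.iterate_fixed (h1 0) n
  have h2' : ∀ n, pd2^[n] (fun _ => 0) = fun _ => 0 := fun n => Function.iterate_fixed (h2 0) n
  rcases j with _ | j
  · obtain ⟨i, rfl⟩ : ∃ n, i = n + 1 := ⟨i - 1, by omega⟩
    rw [Function.iterate_zero_apply, Function.iterate_succ_apply, h1, h1']
  · rw [Function.iterate_succ_apply, h2, h2', h1']

lemma iterate_pd_comp_scaling (a b : ℝ) (i j : ℕ) (G : ℝ × ℝ → ℝ) :
    pd1^[i] (pd2^[j] fun z => G (a * z.1, b * z.2)) =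
      fun z => a ^ i * b ^ j * (pd1^[i] (pd2^[j] G)) (a * z.1, b * z.2) := by
  have h2 : ∀ (c : ℝ) (G : ℝ × ℝ → ℝ), pd2^[j] (fun z => c * G (a * z.1, b * z.2)) =
      fun z => b ^ j * c * (pd2^[j] G) (a * z.1, b * z.2) := by
    induction j with
    | zero => intro c G; simp
    | succ j ih =>
      intro c G
      have : pd2 (fun z => c * G (a * z.1, b * z.2)) =
          fun z => c * b * pd2 G (a * z.1, b * z.2) := by
        ext z
        simp only [pd2, deriv_const_mul_field]
        rw [deriv_comp_mul_left b (fun s => G (a * z.1, s)) z.2, smul_eq_mul, mul_assoc]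
      rw [Function.iterate_succ_apply, Function.iterate_succ_apply, this, ih]
      ext z
      ring
  have h1 : ∀ (c : ℝ) (G : ℝ × ℝ → ℝ), pd1^[i] (fun z => c * G (a * z.1, b * z.2)) =
      fun z => a ^ i * c * (pd1^[i] G) (a * z.1, b * z.2) := by
    induction i with
    | zero => intro c G; simp
    | succ i ih =>
      intro c G
      have : pd1 (fun z => c * G (a * z.1, b * z.2)) =
          fun z => c * a * pd1 G (a * z.1, b * z.2) := by
        ext z
        simp only [pd1, deriv_const_mul_field]
        rw [deriv_comp_mul_left a (fun s => G (s, b * z.2)) z.1, smul_eq_mul, mul_assoc]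
      rw [Function.iterate_succ_apply, Function.iterate_succ_apply, this, ih]
      ext z
      ring
  have := h2 1 G
  simp only [one_mul, mul_one] at this
  rw [this, h1]

/-- The derivative bound for convolution with a fixed Schwartz function. -/
lemma SchwartzMap.exists_iterate_pd_conv_bound (φ : 𝓢(ℝ × ℝ, ℝ)) {α : ℝ} (hα : 0 < α)
    (hα1 : α < 1) {i j : ℕ} (hij : 1 ≤ i + j) :
    ∃ C : ℝ, ∀ (u : ℝ × ℝ → ℝ) (A : ℝ), (∀ x y : ℝ × ℝ, |u x - u y| ≤ A * pdist x y ^ α) →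
      ∀ x, |(pd1^[i] (pd2^[j] fun z => ∫ y, u y * φ (z - y))) x| ≤ C * A := by
  set χ := (fun f : 𝓢(ℝ × ℝ, ℝ) => ∂_{((1, 0) : ℝ × ℝ)} f)^[i]
    ((fun f : 𝓢(ℝ × ℝ, ℝ) => ∂_{((0, 1) : ℝ × ℝ)} f)^[j] φ) with hχ
  have hmean : ∀ z, ∫ y, χ (z - y) = 0 := by
    intro z
    have h := congrFun ((hasLinearGrowth_const 1).iterate_pd_conv φ i j) z
    simp only [one_mul, ← hχ, integral_sub_left_eq_self (fun y => φ y)] at h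
    rw [← h, iterate_pd_const hij]
  have hintegrable : Integrable fun w => pdist w 0 ^ α * |χ w| := by
    have h := (((hasLinearGrowth_pdist_rpow hα hα1).integrable_mul_translate
      (SchwartzMap.compCLMOfContinuousLinearEquiv ℝ (ContinuousLinearEquiv.neg ℝ) χ) 0)).norm
    refine h.congr (.of_forall fun w => ?_)
    simp [abs_of_nonneg (Real.rpow_nonneg (pdist_nonneg w 0) α)]
  refine ⟨∫ w, pdist w 0 ^ α * |χ w|, fun u A hu x => ?_⟩
  have hu' := hasLinearGrowth_of_parabolic_holder hα hα1 hu
  rw [hu'.iterate_pd_conv φ i j]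
  have h1 : ∫ y, u y * χ (x - y) = ∫ y, (u y - u x) * χ (x - y) := by
    simp_rw [sub_mul]
    rw [integral_sub (hu'.integrable_mul_translate χ x)
      ((hasLinearGrowth_const (u x)).integrable_mul_translate χ x), integral_const_mul, hmean]
    simp
  change |∫ y, u y * χ (x - y)| ≤ _
  rw [h1, ← integral_sub_left_eq_self (fun w => pdist w 0 ^ α * |χ w|) volume x,
    ← integral_mul_const, ← Real.norm_eq_abs]
  refine norm_integral_le_of_norm_le ((hintegrable.comp_sub_left x).mul_const A) (.of_forall fun y => ?_)
  rw [norm_mul, Real.norm_eq_abs, Real.norm_eq_abs, abs_sub_comm, pdist_sub_zero]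
  calc |u x - u y| * |χ (x - y)| ≤ A * pdist x y ^ α * |χ (x - y)| := by gcongr; exact hu x y
    _ = _ := by ring

lemma map_scaling_volume {a b : ℝ} (ha : a ≠ 0) (hb : b ≠ 0) :
    Measure.map (fun x : ℝ × ℝ => (a * x.1, b * x.2)) volume =
      ENNReal.ofReal |(a * b)⁻¹| • volume := by
  have hdet : LinearMap.det ((a • LinearMap.id (R := ℝ) (M := ℝ)).prodMap
      (b • LinearMap.id (R := ℝ) (M := ℝ))) = a * b := by
    rw [LinearMap.det_prodMap]
    simp
  have h := Measure.map_linearMap_addHaar_eq_smul_addHaar (volume : Measure (ℝ × ℝ))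
    (hdet ▸ mul_ne_zero ha hb)
  rw [hdet] at h
  exact h

lemma measurableEmbedding_scaling {a b : ℝ} (ha : a ≠ 0) (hb : b ≠ 0) :
    MeasurableEmbedding fun x : ℝ × ℝ => (a * x.1, b * x.2) :=
  ((Homeomorph.mulLeft₀ a ha).prodCongr (Homeomorph.mulLeft₀ b hb)).measurableEmbedding

lemma integral_eq_scaling {E : Type*} [NormedAddCommGroup E] [NormedSpace ℝ E] {a b : ℝ}
    (ha : 0 < a) (hb : 0 < b) (f : ℝ × ℝ → E) :
    ∫ y, f y = (a * b) • ∫ x : ℝ × ℝ, f (a * x.1, b * x.2) := by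
  have h := (measurableEmbedding_scaling ha.ne' hb.ne').integral_map (μ := volume) f
  rw [map_scaling_volume ha.ne' hb.ne', integral_smul_measure] at h
  have hab : 0 < a * b := mul_pos ha hb
  rw [← h, ENNReal.toReal_ofReal (abs_nonneg _), abs_of_pos (inv_pos.2 hab),
    smul_inv_smul₀ hab.ne']

lemma MeasureTheory.Integrable.comp_scaling {f : ℝ × ℝ → ℝ} (hf : Integrable f) {a b : ℝ}
    (ha : a ≠ 0) (hb : b ≠ 0) : Integrable fun x : ℝ × ℝ => f (a * x.1, b * x.2) := by
  rw [← Function.comp_def f, ← (measurableEmbedding_scaling ha hb).integrable_map_iff,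
    map_scaling_volume ha hb]
  exact hf.smul_measure ENNReal.ofReal_ne_top

/-- Injectivity of the Fourier transform on continuous integrable functions on the plane. -/
lemma eq_zero_of_fourier_integral_eq_zero {f : ℝ × ℝ → ℝ} (hc : Continuous f) (hf : Integrable f)
    (h : ∀ k : ℝ × ℝ, (∫ x : ℝ × ℝ,
      Complex.exp (-(2 * Real.pi * (k.1 * x.1 + k.2 * x.2) : ℝ) * Complex.I) * (f x : ℂ)) = 0) :
    f = 0 := by
  let F : WithLp 2 (ℝ × ℝ) → ℂ := fun x => (f (WithLp.ofLp x) : ℂ)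
  have hFc : Continuous F := by
    have : Continuous (@WithLp.ofLp 2 (ℝ × ℝ)) := WithLp.prod_continuous_ofLp 2 ℝ ℝ
    fun_prop
  have hme : MeasurableEmbedding (@WithLp.ofLp 2 (ℝ × ℝ)) :=
    (MeasurableEquiv.toLp 2 (ℝ × ℝ)).symm.measurableEmbedding
  have hmp := WithLp.volume_preserving_ofLp ℝ ℝ
  have hF : Integrable F := (hmp.integrable_comp_emb hme).2 hf.ofReal
  have hF0 : 𝓕 F = 0 := by
    ext k
    rw [Real.fourier_eq', Pi.zero_apply, ← h k.ofLp, ← hmp.integral_comp hme]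
    congr 1
    ext x
    simp only [F, WithLp.prod_inner_apply, smul_eq_mul]
    congr 3
    simp
  have hinv := hFc.fourierInv_fourier_eq hF (hF0 ▸ integrable_zero _ _ _)
  rw [hF0] at hinv
  ext x
  have := congrFun hinv (WithLp.toLp 2 x)
  simp [Real.fourierInv_eq', F] at this
  simpa using this.symm

/-- The parabolic scaling relation of the kernels. -/
lemma IsPsiKernel.scaling {ψ : ℝ → ℝ × ℝ → ℝ} (hψ : IsPsiKernel ψ) {l : ℝ} (hl : 0 < l)
    (x : ℝ × ℝ) : l * l ^ 2 * ψ (l ^ 4) (l * x.1, l ^ 2 * x.2) = ψ 1 x := by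
  obtain ⟨hS, ⟨C, hC⟩, -⟩ := hψ
  obtain ⟨φ, hφ⟩ := hS (l ^ 4) (by positivity)
  obtain ⟨φ₁, hφ₁⟩ := hS 1 one_pos
  have hl2 : 0 < l ^ 2 := by positivity
  have hi : Integrable fun x : ℝ × ℝ => l * l ^ 2 * ψ (l ^ 4) (l * x.1, l ^ 2 * x.2) := by
    rw [hφ]
    exact (φ.integrable.comp_scaling hl.ne' hl2.ne').const_mul _
  have hi₁ : Integrable (ψ 1) := hφ₁ ▸ φ₁.integrable
  have hc : Continuous (ψ (l ^ 4)) := hφ ▸ φ.continuous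
  have hc₁ : Continuous (ψ 1) := hφ₁ ▸ φ₁.continuous
  refine sub_eq_zero.1 (congrFun (eq_zero_of_fourier_integral_eq_zero
    (f := fun x => l * l ^ 2 * ψ (l ^ 4) (l * x.1, l ^ 2 * x.2) - ψ 1 x)
    (by fun_prop) (hi.sub hi₁) fun k => ?_) x)
  have hintegrable : ∀ g : ℝ × ℝ → ℝ, Integrable g → Integrable fun x : ℝ × ℝ =>
      Complex.exp (-(2 * Real.pi * (k.1 * x.1 + k.2 * x.2) : ℝ) * Complex.I) * (g x : ℂ) := by
    intro g hg
    refine hg.ofReal.bdd_mul (c := 1) (by fun_prop) (.of_forall fun x => ?_)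
    rw [← Complex.ofReal_neg, Complex.norm_exp_ofReal_mul_I]
  have hscale := integral_eq_scaling hl hl2 fun y : ℝ × ℝ =>
    Complex.exp (-(2 * Real.pi * (k.1 / l * y.1 + k.2 / l ^ 2 * y.2) : ℝ) * Complex.I) *
      (ψ (l ^ 4) y : ℂ)
  rw [hC (l ^ 4) (by positivity) (k.1 / l, k.2 / l ^ 2), ← integral_smul] at hscale
  simp only [Complex.ofReal_sub, mul_sub]
  rw [integral_sub (hintegrable _ hi) (hintegrable _ hi₁), hC 1 one_pos k, sub_eq_zero]
  trans (C : ℂ) * Complex.exp ((-(l ^ 4 * ((k.1 / l) ^ 4 + (k.2 / l ^ 2) ^ 2)) : ℝ) : ℂ)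
  · rw [hscale]
    congr 1
    ext x
    have e1 : k.1 / l * (l * x.1) = k.1 * x.1 := by field_simp
    have e2 : k.2 / l ^ 2 * (l ^ 2 * x.2) = k.2 * x.2 := by field_simp
    rw [e1, e2, Complex.real_smul, Complex.ofReal_mul (l * l ^ 2)]
    ring
  · congr 4
    field_simp

/-- Convolution with `ψ_T` is convolution with `ψ_1` up to parabolic rescaling. -/
lemma IsPsiKernel.conv_scaling {ψ : ℝ → ℝ × ℝ → ℝ} (hψ : IsPsiKernel ψ) {l : ℝ} (hl : 0 < l)
    (u : ℝ × ℝ → ℝ) (z : ℝ × ℝ) :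
    ∫ y, u y * ψ (l ^ 4) (z - y) =
      ∫ y : ℝ × ℝ, u (l * y.1, l ^ 2 * y.2) * ψ 1 ((l⁻¹ * z.1, (l⁻¹) ^ 2 * z.2) - y) := by
  rw [integral_eq_scaling hl (pow_pos hl 2), smul_eq_mul, ← integral_const_mul]
  congr 1
  ext y
  rw [← hψ.scaling hl]
  have e : (l * ((l⁻¹ * z.1, (l⁻¹) ^ 2 * z.2) - y).1, l ^ 2 * ((l⁻¹ * z.1, (l⁻¹) ^ 2 * z.2) - y).2)
      = z - (l * y.1, l ^ 2 * y.2) := by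
    ext <;> simp <;> field_simp
  rw [e]
  ring

lemma pdist_scaling {l : ℝ} (hl : 0 < l) (x y : ℝ × ℝ) :
    pdist (l * x.1, l ^ 2 * x.2) (l * y.1, l ^ 2 * y.2) = l * pdist x y := by
  simp only [pdist, ← mul_sub, abs_mul, abs_of_pos hl, abs_of_pos (pow_pos hl 2)]
  rw [Real.sqrt_mul (by positivity), Real.sqrt_sq hl.le, mul_add]

/-- bounds on derivatives of `u * ψ_T` for `u` of class `C^α`. -/
theorem psi_convolution_deriv_bound
    (ψ : ℝ → ℝ × ℝ → ℝ) (hψ : IsPsiKernel ψ)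
    (α : ℝ) (hα : 0 < α) (hα1 : α < 1)
    (i j : ℕ) (hij : 1 ≤ i + j) :
    ∃ C : ℝ, ∀ (u : ℝ × ℝ → ℝ) (A : ℝ),
      (∀ x y : ℝ × ℝ, |u x - u y| ≤ A * pdist x y ^ α) →
      ∀ T : ℝ, 0 < T → ∀ x : ℝ × ℝ,
        |(pd1^[i] (pd2^[j] (fun z : ℝ × ℝ => ∫ y : ℝ × ℝ, u y * ψ T (z - y)))) x|
          ≤ C * A * T ^ ((α - (i : ℝ) - 2 * (j : ℝ)) / 4) := by
  obtain ⟨φ, hφ⟩ := hψ.1 1 one_pos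
  obtain ⟨C, hC⟩ := φ.exists_iterate_pd_conv_bound hα hα1 hij
  refine ⟨C, fun u A hu T hT x => ?_⟩
  obtain ⟨l, hl, rfl⟩ : ∃ l : ℝ, 0 < l ∧ l ^ 4 = T :=
    ⟨T ^ ((4 : ℝ)⁻¹), by positivity, Real.rpow_inv_natCast_pow hT.le (n := 4) (by norm_num)⟩
  have hbound := hC (fun y => u (l * y.1, l ^ 2 * y.2)) (A * l ^ α) (fun x y => by
    refine (hu _ _).trans_eq ?_
    rw [pdist_scaling hl, Real.mul_rpow hl.le (pdist_nonneg x y), mul_assoc])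
    (l⁻¹ * x.1, (l⁻¹) ^ 2 * x.2)
  have hconv : (fun z => ∫ y, u y * ψ (l ^ 4) (z - y)) = fun z : ℝ × ℝ =>
      (fun w => ∫ y : ℝ × ℝ, u (l * y.1, l ^ 2 * y.2) * φ (w - y))
        (l⁻¹ * z.1, (l⁻¹) ^ 2 * z.2) := by
    ext z
    rw [hψ.conv_scaling hl, hφ]
  have hpow : (l ^ 4) ^ ((α - (i : ℝ) - 2 * (j : ℝ)) / 4) =
      l⁻¹ ^ i * (l⁻¹ ^ 2) ^ j * l ^ α := by
    rw [← Real.rpow_natCast_mul hl.le, show ((4 : ℕ) : ℝ) * ((α - i - 2 * j) / 4) =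
      α - (i : ℝ) - ((2 * j : ℕ) : ℝ) by push_cast; ring, Real.rpow_sub hl, Real.rpow_sub hl,
      Real.rpow_natCast, Real.rpow_natCast, pow_mul, inv_pow, inv_pow, inv_pow]
    field_simp
  rw [hconv, iterate_pd_comp_scaling l⁻¹ (l⁻¹ ^ 2) i j
    (fun w => ∫ y : ℝ × ℝ, u (l * y.1, l ^ 2 * y.2) * φ (w - y)), hpow, abs_mul, abs_of_pos (by positivity)]
  calc _ ≤ l⁻¹ ^ i * (l⁻¹ ^ 2) ^ j * (C * (A * l ^ α)) := by gcongr
    _ = _ := by ring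
end

section
/- Let α ∈ (0,1) and let f : ℝ² → ℝ be bounded and continuous. Set K := sup_{0 < T ≤ 1} T^{−α/4} · ‖T·(∂₁⁴ − ∂₂² + 1)(f * ψ_T)‖_{L^∞(ℝ²)}. Then there is a constant C(α) such that for all x, y ∈ ℝ², |f(x) − f(y)| ≤ C(α) · K · d(x,y)^α, i.e. the parabolic Hölder seminorm of f satisfies [f]_α ≲ K. -/
open MeasureTheory

/-- The character `x ↦ exp (-2πi k·x)` of the plane. -/
noncomputable def planeChar (k x : ℝ × ℝ) : ℂ :=
  Complex.exp (-(2 * Real.pi * (k.1 * x.1 + k.2 * x.2) : ℝ) * Complex.I)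

/-- The Fourier transform of a real function on the plane. -/
noncomputable def planeFourier (g : ℝ × ℝ → ℝ) (k : ℝ × ℝ) : ℂ :=
  ∫ x : ℝ × ℝ, planeChar k x * (g x : ℂ)

lemma norm_planeChar (k x : ℝ × ℝ) : ‖planeChar k x‖ = 1 := by
  rw [planeChar, ← Complex.ofReal_neg, Complex.norm_exp_ofReal_mul_I]

@[fun_prop]
lemma continuous_planeChar (k : ℝ × ℝ) : Continuous (planeChar k) := by
  unfold planeChar; fun_prop

lemma planeChar_add (k x y : ℝ × ℝ) : planeChar k (x + y) = planeChar k x * planeChar k y := by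
  simp only [planeChar, ← Complex.exp_add]
  congr 1
  push_cast [Prod.fst_add, Prod.snd_add]
  ring

lemma integrable_planeChar_mul {g : ℝ × ℝ → ℝ} (hg : Integrable g) (k : ℝ × ℝ) :
    Integrable fun x => planeChar k x * (g x : ℂ) :=
  hg.ofReal.bdd_mul (continuous_planeChar k).aestronglyMeasurable
    (Filter.Eventually.of_forall fun x => (norm_planeChar k x).le)

lemma planeFourier_sub {g h : ℝ × ℝ → ℝ} (hg : Integrable g) (hh : Integrable h) (k : ℝ × ℝ) :
    planeFourier (fun x => g x - h x) k = planeFourier g k - planeFourier h k := by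
  rw [planeFourier, planeFourier, planeFourier, ← integral_sub (integrable_planeChar_mul hg k)
    (integrable_planeChar_mul hh k)]
  simp only [Complex.ofReal_sub, mul_sub]

lemma planeFourier_add {g h : ℝ × ℝ → ℝ} (hg : Integrable g) (hh : Integrable h) (k : ℝ × ℝ) :
    planeFourier (fun x => g x + h x) k = planeFourier g k + planeFourier h k := by
  rw [planeFourier, planeFourier, planeFourier, ← integral_add (integrable_planeChar_mul hg k)
    (integrable_planeChar_mul hh k)]
  simp only [Complex.ofReal_add, mul_add]

lemma planeFourier_const_mul (c : ℝ) (g : ℝ × ℝ → ℝ) (k : ℝ × ℝ) :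
    planeFourier (fun x => c * g x) k = c * planeFourier g k := by
  rw [planeFourier, planeFourier, ← integral_const_mul]
  congr 1; ext x; push_cast; ring

/-- Integrable functions on the plane with the same Fourier transform agree almost everywhere. -/
lemma ae_eq_of_planeFourier_eq {g h : ℝ × ℝ → ℝ} (hg : Integrable g) (hh : Integrable h)
    (hgh : ∀ k, planeFourier g k = planeFourier h k) : g =ᵐ[volume] h := by
  set u : ℝ × ℝ → ℝ := fun x => g x - h x with hu
  have hui : Integrable u := hg.sub hh
  have hu0 : ∀ k, planeFourier u k = 0 := fun k => by
    rw [hu, planeFourier_sub hg hh, hgh, sub_self]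
  have hp : Integrable fun x => max (u x) 0 := hui.pos_part
  have hn : Integrable fun x => max (-u x) 0 := hui.neg_part
  have hpl : ∫⁻ x, ENNReal.ofReal (u x) ≠ ⊤ := hui.lintegral_lt_top.ne
  have hnl : ∫⁻ x, ENNReal.ofReal (-u x) ≠ ⊤ := hui.neg.lintegral_lt_top.ne
  set μ := (volume : Measure (ℝ × ℝ)).withDensity fun x => ENNReal.ofReal (u x) with hμ
  set ν := (volume : Measure (ℝ × ℝ)).withDensity fun x => ENNReal.ofReal (-u x) with hν
  have : IsFiniteMeasure μ := isFiniteMeasure_withDensity hpl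
  have : IsFiniteMeasure ν := isFiniteMeasure_withDensity hnl
  have hmeas : AEMeasurable u volume := hui.1.aemeasurable
  have hmeasn : AEMeasurable (fun x => -u x) volume := hmeas.neg
  have key : μ = ν := by
    refine Measure.ext_of_charFunDual (funext fun L => ?_)
    obtain ⟨k, hk⟩ : ∃ k : ℝ × ℝ, ∀ x, Complex.exp (L x * Complex.I) = planeChar k x := by
      refine ⟨(-(2 * Real.pi)⁻¹ * L (1, 0), -(2 * Real.pi)⁻¹ * L (0, 1)), fun x => ?_⟩
      have hx : L x = x.1 * L (1, 0) + x.2 * L (0, 1) := by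
        conv_lhs => rw [show x = x.1 • ((1 : ℝ), (0 : ℝ)) + x.2 • ((0 : ℝ), (1 : ℝ)) by
          ext <;> simp]
        rw [map_add, map_smul, map_smul, smul_eq_mul, smul_eq_mul]
      rw [planeChar, hx, ← Complex.ofReal_neg]
      congr 3
      field_simp
      ring
    rw [charFunDual_apply, charFunDual_apply, hμ, hν,
      integral_withDensity_eq_integral_toReal_smul₀ hmeas.ennreal_ofReal (by simp),
      integral_withDensity_eq_integral_toReal_smul₀ hmeasn.ennreal_ofReal (by simp),
      ← sub_eq_zero, ← integral_sub]
    · rw [← hu0 k, planeFourier]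
      congr 1; ext x
      rw [hk, ENNReal.toReal_ofReal', ENNReal.toReal_ofReal', ← sub_smul,
        max_zero_sub_max_neg_zero_eq_self, Complex.real_smul, mul_comm]
    · refine (integrable_planeChar_mul hp k).congr (Filter.Eventually.of_forall fun x => ?_)
      simp only [hk, ENNReal.toReal_ofReal', Complex.real_smul]
      rw [mul_comm]
    · refine (integrable_planeChar_mul hn k).congr (Filter.Eventually.of_forall fun x => ?_)
      simp only [hk, ENNReal.toReal_ofReal', Complex.real_smul]
      rw [mul_comm]
  have := (withDensity_eq_iff hmeas.ennreal_ofReal hmeasn.ennreal_ofReal hpl).1 key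
  filter_upwards [this] with x hx
  have h2 := congrArg ENNReal.toReal hx
  rw [ENNReal.toReal_ofReal', ENNReal.toReal_ofReal'] at h2
  have := max_zero_sub_max_neg_zero_eq_self (u x)
  have hux : u x = g x - h x := rfl
  linarith

/-- The Fourier transform turns convolution into multiplication. -/
lemma planeFourier_convolution {g h : ℝ × ℝ → ℝ} (hg : Integrable g) (hh : Integrable h)
    (k : ℝ × ℝ) :
    planeFourier (fun x => ∫ y, g y * h (x - y)) k = planeFourier g k * planeFourier h k := by
  have := integral_convolution (ContinuousLinearMap.mul ℝ ℂ) (integrable_planeChar_mul hg k)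
    (integrable_planeChar_mul hh k)
  rw [ContinuousLinearMap.mul_apply'] at this
  rw [planeFourier, planeFourier, planeFourier, ← this]
  congr 1; ext x
  rw [convolution_def, ← integral_complex_ofReal, ← integral_const_mul]
  congr 1; ext y
  rw [ContinuousLinearMap.mul_apply']
  have : planeChar k x = planeChar k y * planeChar k (x - y) := by
    rw [← planeChar_add, add_sub_cancel]
  rw [this]
  push_cast
  ring

lemma integrable_plane_convolution {g h : ℝ × ℝ → ℝ} (hg : Integrable g) (hh : Integrable h) :
    Integrable fun x => ∫ y, g y * h (x - y) :=
  hg.integrable_convolution (ContinuousLinearMap.mul ℝ ℝ) hh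

open scoped LineDeriv in
lemma planeFourier_lineDerivOp (g : SchwartzMap (ℝ × ℝ) ℝ) (v k : ℝ × ℝ) :
    planeFourier (∂_{v} g : SchwartzMap (ℝ × ℝ) ℝ) k
      = (2 * Real.pi * (k.1 * v.1 + k.2 * v.2) : ℝ) * Complex.I * planeFourier g k := by
  have hd : ∀ x, HasLineDerivAt ℝ (planeChar k)
      (-((2 * Real.pi * (k.1 * v.1 + k.2 * v.2) : ℝ) * Complex.I) * planeChar k x) x v := by
    intro x
    have h1 : HasDerivAt (fun t : ℝ => t * (-((2 * Real.pi * (k.1 * v.1 + k.2 * v.2) : ℝ) *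
      Complex.I)) : ℝ → ℂ) (-((2 * Real.pi * (k.1 * v.1 + k.2 * v.2) : ℝ) * Complex.I)) 0 := by
      simpa using (Complex.ofRealCLM.hasDerivAt (x := (0 : ℝ))).mul_const
        (-((2 * Real.pi * (k.1 * v.1 + k.2 * v.2) : ℝ) * Complex.I))
    have h2 := (h1.cexp).mul_const (planeChar k x)
    simp only [Complex.ofReal_zero, zero_mul, Complex.exp_zero, one_mul] at h2
    refine h2.congr_of_eventuallyEq (Filter.Eventually.of_forall fun t => ?_)
    simp only [planeChar, ← Complex.exp_add]
    congr 1
    push_cast [Prod.fst_add, Prod.snd_add, Prod.smul_fst, Prod.smul_snd, smul_eq_mul]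
    ring
  have hg : ∀ x, HasLineDerivAt ℝ (fun x => (g x : ℂ))
      (((∂_{v} g : SchwartzMap (ℝ × ℝ) ℝ) x : ℝ) : ℂ) x v := fun x =>
    ((g.hasFDerivAt x).hasLineDerivAt v).ofReal_comp
  have := integral_bilinear_hasLineDerivAt_right_eq_neg_left_of_integrable (μ := volume)
    (B := ContinuousLinearMap.mul ℝ ℂ) (f := planeChar k) (g := fun x => (g x : ℂ)) (v := v)
    (f' := fun x => -((2 * Real.pi * (k.1 * v.1 + k.2 * v.2) : ℝ) * Complex.I) * planeChar k x)
    (g' := fun x => (((∂_{v} g : SchwartzMap (ℝ × ℝ) ℝ) x : ℝ) : ℂ)) ?_ ?_ ?_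
    (fun x _ => hd x) (fun x _ => hg x)
  · simp only [ContinuousLinearMap.mul_apply'] at this
    rw [planeFourier, this, planeFourier, ← integral_const_mul, ← integral_neg]
    congr 1; ext x; ring
  · simp only [ContinuousLinearMap.mul_apply', mul_assoc (-_) (planeChar _ _)]
    exact (integrable_planeChar_mul g.integrable k).const_mul _
  · exact integrable_planeChar_mul (∂_{v} g : SchwartzMap (ℝ × ℝ) ℝ).integrable k
  · exact integrable_planeChar_mul g.integrable k

lemma SchwartzMap.exists_integrable_bound_add {V : Type*} [NormedAddCommGroup V] [NormedSpace ℝ V]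
    (g : SchwartzMap (ℝ × ℝ) V) :
    ∃ b : ℝ × ℝ → ℝ, Integrable b ∧ ∀ x u, ‖u‖ ≤ 1 → ‖g (x + u)‖ ≤ b x := by
  obtain ⟨c, hc⟩ : ∃ c : ℝ, ∀ x, (1 + ‖x‖) ^ 3 * ‖g x‖ ≤ c := by
    have := SchwartzMap.one_add_le_sup_seminorm_apply (𝕜 := ℝ) (m := (3, 0)) (k := 3) (n := 0)
      le_rfl le_rfl g
    simp only [norm_iteratedFDeriv_zero] at this
    exact ⟨_, this⟩
  have hc0 : 0 ≤ c := le_trans (by positivity) (hc 0)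
  refine ⟨fun x => 8 * c * (1 + ‖x‖) ^ (-3 : ℝ),
    (integrable_one_add_norm (by simp; norm_num)).const_mul _, fun x u hu => ?_⟩
  have hx : 0 < 1 + ‖x‖ := by positivity
  have h1 : 1 + ‖x‖ ≤ 2 * (1 + ‖x + u‖) := by
    have : ‖x‖ ≤ ‖x + u‖ + ‖u‖ := by simpa using norm_sub_le (x + u) u
    linarith [norm_nonneg (x + u)]
  have h2 : (1 + ‖x‖) ^ 3 ≤ 8 * (1 + ‖x + u‖) ^ 3 := by
    calc (1 + ‖x‖) ^ 3 ≤ (2 * (1 + ‖x + u‖)) ^ 3 := by gcongr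
      _ = _ := by ring
  beta_reduce
  rw [Real.rpow_neg hx.le, show (3 : ℝ) = (3 : ℕ) by norm_num, Real.rpow_natCast, ← div_eq_mul_inv,
    le_div_iff₀ (by positivity)]
  nlinarith [hc (x + u), mul_le_mul_of_nonneg_left h2 (norm_nonneg (g (x + u)))]

lemma integrable_bounded_mul {f g : ℝ × ℝ → ℝ} (hf : AEStronglyMeasurable f)
    {B : ℝ} (hB : ∀ x, |f x| ≤ B) (hg : Integrable g) : Integrable fun y => f y * g y :=
  hg.bdd_mul hf (Filter.Eventually.of_forall hB)

open scoped LineDeriv in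
lemma hasDerivAt_convolution_schwartz {f : ℝ × ℝ → ℝ} (hf : Continuous f) {B : ℝ}
    (hB : ∀ x, |f x| ≤ B) (g : SchwartzMap (ℝ × ℝ) ℝ) {v : ℝ × ℝ} (hv : ‖v‖ ≤ 1) (z : ℝ × ℝ)
    (s₀ : ℝ) :
    HasDerivAt (fun s : ℝ => ∫ y, f y * g (z + (s - s₀) • v - y))
      (∫ y, f y * (∂_{v} g : SchwartzMap (ℝ × ℝ) ℝ) (z - y)) s₀ := by
  obtain ⟨b, hbi, hb⟩ := (∂_{v} g : SchwartzMap (ℝ × ℝ) ℝ).exists_integrable_bound_add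
  have hfm := hf.aestronglyMeasurable (μ := volume)
  have hB0 : 0 ≤ B := (abs_nonneg _).trans (hB 0)
  have := (hasDerivAt_integral_of_dominated_loc_of_deriv_le (μ := volume)
    (F := fun s y => f y * g (z + (s - s₀) • v - y))
    (F' := fun s y => f y * (∂_{v} g : SchwartzMap (ℝ × ℝ) ℝ) (z + (s - s₀) • v - y))
    (x₀ := s₀) (bound := fun y => B * b (z - y)) (Metric.ball_mem_nhds s₀ one_pos)
    (Filter.Eventually.of_forall fun s => ?_) ?_ ?_ (Filter.Eventually.of_forall fun y s hs => ?_)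
    ((hbi.comp_sub_left z).const_mul B) (Filter.Eventually.of_forall fun y s _ => ?_)).2
  · simpa using this
  · exact (hf.mul (g.continuous.comp (by fun_prop))).aestronglyMeasurable
  · exact integrable_bounded_mul hfm hB (g.integrable.comp_sub_left _)
  · exact (hf.mul ((∂_{v} g : SchwartzMap (ℝ × ℝ) ℝ).continuous.comp
      (by fun_prop))).aestronglyMeasurable
  · rw [norm_mul]
    refine mul_le_mul (hB y) ?_ (norm_nonneg _) hB0
    rw [show z + (s - s₀) • v - y = (z - y) + (s - s₀) • v by abel]
    refine hb _ _ ?_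
    rw [norm_smul]
    exact mul_le_one₀ (by rw [← dist_eq_norm]; exact (Metric.mem_ball.1 hs).le)
      (norm_nonneg _) hv
  · refine HasDerivAt.const_mul _ ?_
    have h1 : HasDerivAt (fun s : ℝ => z + (s - s₀) • v - y) v s := by
      simpa using ((((hasDerivAt_id s).sub_const s₀).smul_const v).const_add z).sub_const y
    exact (g.hasFDerivAt _).comp_hasDerivAt s h1

open scoped LineDeriv in
lemma pd1_convolution_schwartz {f : ℝ × ℝ → ℝ} (hf : Continuous f) {B : ℝ}
    (hB : ∀ x, |f x| ≤ B) (g : SchwartzMap (ℝ × ℝ) ℝ) :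
    pd1 (fun z => ∫ y, f y * g (z - y))
      = fun z => ∫ y, f y * (∂_{((1 : ℝ), (0 : ℝ))} g : SchwartzMap (ℝ × ℝ) ℝ) (z - y) := by
  ext z
  rw [← (hasDerivAt_convolution_schwartz hf hB g (v := (1, 0)) (by simp [Prod.norm_def]) z
    z.1).deriv]
  simp only [pd1]
  congr 1; ext s
  congr 1; ext y
  congr 3
  ext <;> simp

open scoped LineDeriv in
lemma pd2_convolution_schwartz {f : ℝ × ℝ → ℝ} (hf : Continuous f) {B : ℝ}
    (hB : ∀ x, |f x| ≤ B) (g : SchwartzMap (ℝ × ℝ) ℝ) :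
    pd2 (fun z => ∫ y, f y * g (z - y))
      = fun z => ∫ y, f y * (∂_{((0 : ℝ), (1 : ℝ))} g : SchwartzMap (ℝ × ℝ) ℝ) (z - y) := by
  ext z
  rw [← (hasDerivAt_convolution_schwartz hf hB g (v := (0, 1)) (by simp [Prod.norm_def]) z
    z.2).deriv]
  simp only [pd2]
  congr 1; ext s
  congr 1; ext y
  congr 3
  ext <;> simp

/-- The `L¹` modulus of continuity of a Schwartz function is Lipschitz. -/
lemma SchwartzMap.exists_integral_translate_sub_le (g : SchwartzMap (ℝ × ℝ) ℝ) :
    ∃ L : ℝ, ∀ h : ℝ × ℝ, ∫ x, |g (x + h) - g x| ≤ L * ‖h‖ := by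
  obtain ⟨b, hbi, hb⟩ := (SchwartzMap.fderivCLM ℝ (ℝ × ℝ) ℝ g).exists_integrable_bound_add
  have hb0 : ∀ x, 0 ≤ b x := fun x => (norm_nonneg _).trans (hb x 0 (by simp))
  have hb1 : 0 ≤ ∫ x, b x := integral_nonneg hb0
  have hI : 0 ≤ ∫ x, |g x| := integral_nonneg fun x => abs_nonneg _
  refine ⟨(∫ x, b x) + 2 * ∫ x, |g x|, fun h => ?_⟩
  have hgh : Integrable fun x => g (x + h) := g.integrable.comp_add_right h
  have hdiff : Integrable fun x => |g (x + h) - g x| := (hgh.sub g.integrable).abs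
  rcases le_total ‖h‖ 1 with h1 | h1
  · calc ∫ x, |g (x + h) - g x| ≤ ∫ x, b x * ‖h‖ := by
          refine integral_mono hdiff (hbi.mul_const _) fun x => ?_
          have := (convex_closedBall x ‖h‖).norm_image_sub_le_of_norm_fderiv_le (𝕜 := ℝ)
            (f := g) (C := b x) (x := x) (y := x + h) (fun y _ => g.differentiableAt)
            (fun y hy => ?_) (by simp) (by simp)
          · simpa using this
          · have := hb x (y - x)
              (by rw [← dist_eq_norm]; exact (Metric.mem_closedBall.1 hy).trans h1)
            simpa using this
      _ = (∫ x, b x) * ‖h‖ := integral_mul_const _ _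
      _ ≤ _ := by gcongr; linarith
  · calc ∫ x, |g (x + h) - g x| ≤ ∫ x, (|g (x + h)| + |g x|) :=
          integral_mono hdiff (hgh.abs.add g.integrable.abs) fun x => abs_sub _ _
      _ = 2 * ∫ x, |g x| := by
          rw [integral_add hgh.abs g.integrable.abs, integral_add_right_eq_self (fun x => |g x|) h]
          ring
      _ ≤ (∫ x, b x) + 2 * ∫ x, |g x| := by linarith
      _ ≤ _ := le_mul_of_one_le_right (by linarith) h1

/-- The anisotropic dilation of `g`, normalised to preserve the integral. -/
def planeDilate (a b : ℝ) (g : ℝ × ℝ → ℝ) (x : ℝ × ℝ) : ℝ := a * b * g (a * x.1, b * x.2)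

lemma measurableEmbedding_dilation {a b : ℝ} (ha : 0 < a) (hb : 0 < b) :
    MeasurableEmbedding fun x : ℝ × ℝ => (a * x.1, b * x.2) :=
  (measurableEmbedding_mulLeft₀ ha.ne').prodMap (measurableEmbedding_mulLeft₀ hb.ne')

lemma map_dilation_volume {a b : ℝ} (ha : 0 < a) (hb : 0 < b) :
    Measure.map (fun x : ℝ × ℝ => (a * x.1, b * x.2)) volume
      = ENNReal.ofReal (a * b)⁻¹ • (volume : Measure (ℝ × ℝ)) := by
  have h := Measure.map_prod_map (volume : Measure ℝ) (volume : Measure ℝ)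
    (measurable_const_mul a) (measurable_const_mul b)
  rw [Real.map_volume_mul_left ha.ne', Real.map_volume_mul_left hb.ne'] at h
  change Measure.map (Prod.map (a * ·) (b * ·)) (Measure.prod volume volume) = _
  rw [← h, Measure.prod_smul_left, Measure.prod_smul_right, smul_smul,
    ← ENNReal.ofReal_mul (abs_nonneg _), ← abs_mul, ← mul_inv, abs_of_pos (by positivity)]
  rfl

lemma integral_comp_dilation {V : Type*} [NormedAddCommGroup V] [NormedSpace ℝ V] {a b : ℝ}
    (ha : 0 < a) (hb : 0 < b) (h : ℝ × ℝ → V) :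
    ∫ x : ℝ × ℝ, (a * b) • h (a * x.1, b * x.2) = ∫ x, h x := by
  have := (measurableEmbedding_dilation ha hb).integral_map (μ := volume) h
  rw [map_dilation_volume ha hb, integral_smul_measure,
    ENNReal.toReal_ofReal (by positivity)] at this
  rw [integral_smul, ← this, smul_smul, mul_inv_cancel₀ (by positivity), one_smul]

lemma MeasureTheory.Integrable.planeDilate {a b : ℝ} (ha : 0 < a) (hb : 0 < b) {g : ℝ × ℝ → ℝ}
    (hg : Integrable g) : Integrable (planeDilate a b g) := by
  refine Integrable.const_mul ?_ _
  refine ((measurableEmbedding_dilation ha hb).integrable_map_iff (g := g)).1 ?_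
  rw [map_dilation_volume ha hb]
  exact hg.smul_measure ENNReal.ofReal_ne_top

lemma integral_mul_planeDilate {a b : ℝ} (ha : 0 < a) (hb : 0 < b) (f g : ℝ × ℝ → ℝ) :
    ∫ x, f x * planeDilate a b g x = ∫ x, f (a⁻¹ * x.1, b⁻¹ * x.2) * g x := by
  rw [← integral_comp_dilation ha hb fun x => f (a⁻¹ * x.1, b⁻¹ * x.2) * g x]
  congr 1; ext x
  rw [planeDilate, smul_eq_mul, inv_mul_cancel_left₀ ha.ne', inv_mul_cancel_left₀ hb.ne']
  ring

lemma integral_abs_planeDilate {a b : ℝ} (ha : 0 < a) (hb : 0 < b) (g : ℝ × ℝ → ℝ) :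
    ∫ x, |planeDilate a b g x| = ∫ x, |g x| := by
  rw [← integral_comp_dilation ha hb fun x => |g x|]
  congr 1; ext x
  rw [planeDilate, abs_mul, abs_of_pos (mul_pos ha hb), smul_eq_mul]

lemma integral_abs_planeDilate_sub {a b : ℝ} (ha : 0 < a) (hb : 0 < b) (g : ℝ × ℝ → ℝ)
    (h : ℝ × ℝ) :
    ∫ x, |planeDilate a b g (x + h) - planeDilate a b g x|
      = ∫ x, |g (x + (a * h.1, b * h.2)) - g x| := by
  rw [← integral_comp_dilation ha hb fun x => |g (x + (a * h.1, b * h.2)) - g x|]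
  congr 1; ext x
  rw [planeDilate, planeDilate, ← mul_sub, abs_mul, abs_of_pos (mul_pos ha hb), smul_eq_mul]
  simp only [mul_add, Prod.add_def]

lemma planeFourier_planeDilate {a b : ℝ} (ha : 0 < a) (hb : 0 < b) (g : ℝ × ℝ → ℝ) (k : ℝ × ℝ) :
    planeFourier (planeDilate a b g) k = planeFourier g (k.1 / a, k.2 / b) := by
  rw [planeFourier, planeFourier,
    ← integral_comp_dilation ha hb fun x => planeChar (k.1 / a, k.2 / b) x * (g x : ℂ)]
  congr 1; ext x
  have : planeChar (k.1 / a, k.2 / b) (a * x.1, b * x.2) = planeChar k x := by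
    simp only [planeChar]
    rw [show k.1 / a * (a * x.1) = k.1 * x.1 by field_simp,
      show k.2 / b * (b * x.2) = k.2 * x.2 by field_simp]
  rw [this, planeDilate, Complex.real_smul]
  push_cast
  ring

/-- The symbol of `∂₁⁴ - ∂₂² + 1`. -/
noncomputable def parabolicSymbol (k : ℝ × ℝ) : ℝ :=
  (2 * Real.pi * k.1) ^ 4 + (2 * Real.pi * k.2) ^ 2 + 1

lemma parabolicSymbol_pos (k : ℝ × ℝ) : 0 < parabolicSymbol k := by
  unfold parabolicSymbol; positivity

/-- If `φ` has Fourier transform `exp (-(k₁⁴ + k₂²))`, then `dampedKernel φ T r` is the kernel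
with symbol `exp (-r ((2πk₁)⁴ + (2πk₂)² + 1) + T (k₁⁴ + k₂²))`. -/
noncomputable def dampedKernel (φ : ℝ × ℝ → ℝ) (T r : ℝ) (x : ℝ × ℝ) : ℝ :=
  Real.exp (-r) * planeDilate (((2 * Real.pi) ^ 4 * r - T) ^ (-(1 / 4) : ℝ))
    (((2 * Real.pi) ^ 2 * r - T) ^ (-(1 / 2) : ℝ)) φ x

lemma one_le_two_pi : (1 : ℝ) ≤ 2 * Real.pi := by linarith [Real.pi_gt_three]

lemma le_two_pi_pow_mul_sub {T r : ℝ} (hr : 0 < r) (hT : T ≤ r) :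
    r ≤ (2 * Real.pi) ^ 4 * r - T ∧ r ≤ (2 * Real.pi) ^ 2 * r - T := by
  have h2 : (2 : ℝ) ≤ (2 * Real.pi) ^ 2 := by nlinarith [Real.pi_gt_three]
  have h4 : (2 * Real.pi) ^ 2 ≤ (2 * Real.pi) ^ 4 := pow_le_pow_right₀ one_le_two_pi (by norm_num)
  constructor <;> nlinarith

lemma two_pi_pow_mul_sub_pos {T r : ℝ} (hr : 0 < r) (hT : T ≤ r) :
    0 < ((2 * Real.pi) ^ 4 * r - T) ^ (-(1 / 4) : ℝ) ∧
      0 < ((2 * Real.pi) ^ 2 * r - T) ^ (-(1 / 2) : ℝ) := by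
  obtain ⟨h1, h2⟩ := le_two_pi_pow_mul_sub hr hT
  exact ⟨Real.rpow_pos_of_pos (hr.trans_le h1) _, Real.rpow_pos_of_pos (hr.trans_le h2) _⟩

lemma integrable_dampedKernel {φ : ℝ × ℝ → ℝ} (hφ : Integrable φ) {T r : ℝ} (hr : 0 < r)
    (hT : T ≤ r) : Integrable (dampedKernel φ T r) := by
  obtain ⟨ha, hb⟩ := two_pi_pow_mul_sub_pos hr hT
  exact (hφ.planeDilate ha hb).const_mul _

lemma integral_abs_dampedKernel (φ : ℝ × ℝ → ℝ) {T r : ℝ} (hr : 0 < r) (hT : T ≤ r) :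
    ∫ x, |dampedKernel φ T r x| = Real.exp (-r) * ∫ x, |φ x| := by
  obtain ⟨ha, hb⟩ := two_pi_pow_mul_sub_pos hr hT
  rw [← integral_abs_planeDilate ha hb φ, ← integral_const_mul]
  simp only [dampedKernel, abs_mul, Real.abs_exp]

lemma integral_abs_dampedKernel_sub_le {φ : ℝ × ℝ → ℝ} {L : ℝ}
    (hL : ∀ h : ℝ × ℝ, ∫ x, |φ (x + h) - φ x| ≤ L * ‖h‖) {T r : ℝ} (hr : 0 < r) (hT : T ≤ r)
    (h : ℝ × ℝ) :
    ∫ x, |dampedKernel φ T r (x + h) - dampedKernel φ T r x|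
      ≤ Real.exp (-r) * (L * max (r ^ (-(1 / 4) : ℝ) * |h.1|) (r ^ (-(1 / 2) : ℝ) * |h.2|)) := by
  obtain ⟨ha, hb⟩ := two_pi_pow_mul_sub_pos hr hT
  obtain ⟨ha', hb'⟩ := le_two_pi_pow_mul_sub hr hT
  have hL0 : 0 ≤ L := by
    have := (integral_nonneg fun x => abs_nonneg (φ (x + (1, 1)) - φ x)).trans (hL (1, 1))
    simpa [Prod.norm_def] using this
  calc ∫ x, |dampedKernel φ T r (x + h) - dampedKernel φ T r x|
      = Real.exp (-r) * ∫ x, |planeDilate (((2 * Real.pi) ^ 4 * r - T) ^ (-(1 / 4) : ℝ))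
        (((2 * Real.pi) ^ 2 * r - T) ^ (-(1 / 2) : ℝ)) φ (x + h) -
        planeDilate (((2 * Real.pi) ^ 4 * r - T) ^ (-(1 / 4) : ℝ))
        (((2 * Real.pi) ^ 2 * r - T) ^ (-(1 / 2) : ℝ)) φ x| := by
        rw [← integral_const_mul]
        simp only [dampedKernel, ← mul_sub, abs_mul, Real.abs_exp]
    _ ≤ _ := by
        rw [integral_abs_planeDilate_sub ha hb]
        refine mul_le_mul_of_nonneg_left ((hL _).trans ?_) (Real.exp_nonneg _)
        refine mul_le_mul_of_nonneg_left ?_ hL0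
        rw [Prod.norm_def]
        simp only [norm_mul, Real.norm_eq_abs, abs_of_pos ha, abs_of_pos hb]
        exact max_le_max
          (mul_le_mul_of_nonneg_right (Real.rpow_le_rpow_of_nonpos hr ha' (by norm_num))
            (abs_nonneg _))
          (mul_le_mul_of_nonneg_right (Real.rpow_le_rpow_of_nonpos hr hb' (by norm_num))
            (abs_nonneg _))

lemma planeFourier_dampedKernel {φ : ℝ × ℝ → ℝ}
    (hφ : ∀ k, planeFourier φ k = Complex.exp ((-(k.1 ^ 4 + k.2 ^ 2) : ℝ) : ℂ)) {T r : ℝ}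
    (hr : 0 < r) (hT : T ≤ r) (k : ℝ × ℝ) :
    planeFourier (dampedKernel φ T r) k
      = Complex.exp ((T * (k.1 ^ 4 + k.2 ^ 2) : ℝ) : ℂ)
        * Complex.exp (-(parabolicSymbol k : ℂ) * (r : ℂ)) := by
  obtain ⟨ha, hb⟩ := two_pi_pow_mul_sub_pos hr hT
  obtain ⟨ha', hb'⟩ := le_two_pi_pow_mul_sub hr hT
  change planeFourier (fun x => _ * planeDilate _ _ φ x) k = _
  rw [planeFourier_const_mul, planeFourier_planeDilate ha hb, hφ, Complex.ofReal_exp,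
    ← Complex.exp_add, ← Complex.exp_add]
  congr 1
  have h4 : (k.1 / ((2 * Real.pi) ^ 4 * r - T) ^ (-(1 / 4) : ℝ)) ^ 4
      = k.1 ^ 4 * ((2 * Real.pi) ^ 4 * r - T) := by
    rw [div_pow, ← Real.rpow_mul_natCast (hr.trans_le ha').le]
    norm_num [Real.rpow_neg_one]
  have h2 : (k.2 / ((2 * Real.pi) ^ 2 * r - T) ^ (-(1 / 2) : ℝ)) ^ 2
      = k.2 ^ 2 * ((2 * Real.pi) ^ 2 * r - T) := by
    rw [div_pow, ← Real.rpow_mul_natCast (hr.trans_le hb').le]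
    norm_num [Real.rpow_neg_one]
  simp only [h4, h2, parabolicSymbol]
  push_cast
  ring

lemma integrable_dampedKernel_prod {φ : ℝ × ℝ → ℝ} (hφc : Continuous φ) (hφ : Integrable φ)
    {T s : ℝ} (hs : 0 < s) (hT : T ≤ s) :
    Integrable (fun p : ℝ × (ℝ × ℝ) => dampedKernel φ T p.1 p.2)
      ((volume.restrict (Set.Ioc s (2 * s))).prod volume) := by
  have hmeas : Measurable fun p : ℝ × (ℝ × ℝ) => dampedKernel φ T p.1 p.2 := by
    have := hφc.measurable
    unfold dampedKernel planeDilate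
    fun_prop
  refine (integrable_prod_iff hmeas.aestronglyMeasurable).2 ⟨?_, ?_⟩
  · filter_upwards [ae_restrict_mem measurableSet_Ioc] with r hr
    exact integrable_dampedKernel hφ (hs.trans hr.1) (hT.trans hr.1.le)
  · have h1 : Integrable (fun r => Real.exp (-r) * ∫ x, |φ x|)
        (volume.restrict (Set.Ioc s (2 * s))) :=
      (Continuous.integrableOn_Ioc (by fun_prop))
    refine h1.congr ?_
    filter_upwards [ae_restrict_mem measurableSet_Ioc] with r hr
    exact (integral_abs_dampedKernel φ (hs.trans hr.1) (hT.trans hr.1.le)).symm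

lemma symbol_mul_planeFourier_integral_dampedKernel {φ : ℝ × ℝ → ℝ} (hφc : Continuous φ)
    (hφi : Integrable φ)
    (hφ : ∀ k, planeFourier φ k = Complex.exp ((-(k.1 ^ 4 + k.2 ^ 2) : ℝ) : ℂ)) {T s : ℝ}
    (hs : 0 < s) (hT : T ≤ s) (k : ℝ × ℝ) :
    parabolicSymbol k * planeFourier (fun x => ∫ r in Set.Ioc s (2 * s), dampedKernel φ T r x) k
      = Complex.exp ((T * (k.1 ^ 4 + k.2 ^ 2) : ℝ) : ℂ)
        * (Complex.exp (-(parabolicSymbol k : ℂ) * (s : ℂ))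
          - Complex.exp (-(parabolicSymbol k : ℂ) * ((2 * s : ℝ) : ℂ))) := by
  have hM : (parabolicSymbol k : ℂ) ≠ 0 := by exact_mod_cast (parabolicSymbol_pos k).ne'
  have hI := integrable_dampedKernel_prod hφc hφi hs hT
  have hswap : planeFourier (fun x => ∫ r in Set.Ioc s (2 * s), dampedKernel φ T r x) k
      = ∫ r in Set.Ioc s (2 * s), planeFourier (dampedKernel φ T r) k := by
    simp only [planeFourier]
    rw [integral_integral_swap (f := fun r x => planeChar k x * (dampedKernel φ T r x : ℂ))]
    · congr 1; ext x
      rw [← integral_complex_ofReal, ← integral_const_mul]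
    · exact hI.ofReal.bdd_mul
        ((continuous_planeChar k).comp continuous_snd).aestronglyMeasurable
        (Filter.Eventually.of_forall fun p => (norm_planeChar k p.2).le)
  have hdiff : ∫ r in Set.Ioc s (2 * s), planeFourier (dampedKernel φ T r) k
      = ∫ r in s..2 * s, Complex.exp ((T * (k.1 ^ 4 + k.2 ^ 2) : ℝ) : ℂ)
        * Complex.exp (-(parabolicSymbol k : ℂ) * (r : ℂ)) := by
    rw [intervalIntegral.integral_of_le (by linarith)]
    refine setIntegral_congr_fun measurableSet_Ioc fun r hr => ?_
    exact planeFourier_dampedKernel hφ (hs.trans hr.1) (hT.trans hr.1.le) k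
  rw [hswap, hdiff, intervalIntegral.integral_const_mul,
    integral_exp_mul_complex (neg_ne_zero.2 hM)]
  field_simp
  ring

lemma plane_convolution_assoc {f g h : ℝ × ℝ → ℝ} (hf : Continuous f) {B : ℝ}
    (hB : ∀ x, |f x| ≤ B) (hg : Integrable g) (hh : Integrable h) (x : ℝ × ℝ) :
    ∫ z, (∫ y, f y * g (z - y)) * h (x - z) = ∫ y, f y * ∫ z, g z * h (x - y - z) := by
  refine convolution_assoc' (ContinuousLinearMap.mul ℝ ℝ) (ContinuousLinearMap.mul ℝ ℝ)
    (ContinuousLinearMap.mul ℝ ℝ) (ContinuousLinearMap.mul ℝ ℝ) (μ := volume) (ν := volume)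
    (fun x y z => mul_assoc x y z) (Filter.Eventually.of_forall fun z => ?_)
    (hg.ae_convolution_exists _ hh) ?_
  · exact integrable_bounded_mul hf.aestronglyMeasurable hB (hg.comp_sub_left z)
  · have h1 := ((hh.comp_sub_left x).convolution_integrand (ContinuousLinearMap.mul ℝ ℝ)
      hg.comp_neg).swap
    refine (h1.bdd_mul (f := fun p : (ℝ × ℝ) × (ℝ × ℝ) => f p.2)
      (hf.comp continuous_snd).aestronglyMeasurable
      (Filter.Eventually.of_forall fun p => hB p.2)).congr (Filter.Eventually.of_forall fun p => ?_)
    simp [Function.uncurry, mul_comm]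

open scoped LineDeriv in
/-- The operator `∂₁⁴ - ∂₂² + 1` on Schwartz functions. -/
noncomputable def parabolicOp (g : SchwartzMap (ℝ × ℝ) ℝ) : SchwartzMap (ℝ × ℝ) ℝ :=
  ∂_{((1 : ℝ), (0 : ℝ))} (∂_{((1 : ℝ), (0 : ℝ))} (∂_{((1 : ℝ), (0 : ℝ))}
    (∂_{((1 : ℝ), (0 : ℝ))} g))) - ∂_{((0 : ℝ), (1 : ℝ))} (∂_{((0 : ℝ), (1 : ℝ))} g) + g

lemma planeFourier_parabolicOp (g : SchwartzMap (ℝ × ℝ) ℝ) (k : ℝ × ℝ) :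
    planeFourier (parabolicOp g) k = parabolicSymbol k * planeFourier g k := by
  change planeFourier (fun x => (_ : SchwartzMap (ℝ × ℝ) ℝ) x + g x) k = _
  rw [planeFourier_add (SchwartzMap.integrable _) g.integrable]
  change planeFourier (fun x => (_ : SchwartzMap (ℝ × ℝ) ℝ) x
    - (_ : SchwartzMap (ℝ × ℝ) ℝ) x) k + _ = _
  rw [planeFourier_sub (SchwartzMap.integrable _) (SchwartzMap.integrable _)]
  simp only [planeFourier_lineDerivOp, parabolicSymbol]
  have h2 : Complex.I ^ 2 = -1 := Complex.I_sq
  have h4 : Complex.I ^ 4 = 1 := Complex.I_pow_four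
  push_cast
  ring_nf
  rw [h2, h4]
  ring

lemma parabolicOp_convolution {f : ℝ × ℝ → ℝ} (hf : Continuous f) {B : ℝ}
    (hB : ∀ x, |f x| ≤ B) (g : SchwartzMap (ℝ × ℝ) ℝ) (x : ℝ × ℝ) :
    (pd1^[4] (fun z : ℝ × ℝ => ∫ y : ℝ × ℝ, f y * g (z - y))) x
        - pd2 (pd2 (fun z : ℝ × ℝ => ∫ y : ℝ × ℝ, f y * g (z - y))) x
        + (∫ y : ℝ × ℝ, f y * g (x - y))
      = ∫ y, f y * parabolicOp g (x - y) := by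
  have hi : ∀ u : SchwartzMap (ℝ × ℝ) ℝ, Integrable fun y => f y * u (x - y) := fun u =>
    integrable_bounded_mul hf.aestronglyMeasurable hB (u.integrable.comp_sub_left x)
  simp only [Function.iterate_succ, Function.iterate_zero, Function.comp_apply, id_eq,
    pd1_convolution_schwartz hf hB, pd2_convolution_schwartz hf hB]
  refine (congrArg (· + _) (integral_sub (hi _) (hi _)).symm).trans ?_
  refine (integral_add ((hi _).sub (hi _)) (hi _)).symm.trans ?_
  congr 1; ext y
  simp only [Pi.sub_apply, parabolicOp, add_apply, sub_apply]
  ring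

/-- The difference of two kernels of the semigroup as a convolution. -/
lemma dampedKernel_sub_ae_eq {φ : SchwartzMap (ℝ × ℝ) ℝ}
    (hφ : ∀ k, planeFourier φ k = Complex.exp ((-(k.1 ^ 4 + k.2 ^ 2) : ℝ) : ℂ))
    {g : SchwartzMap (ℝ × ℝ) ℝ} {c T s : ℝ}
    (hc : c ≠ 0) (hs : 0 < s) (hT : T ≤ s)
    (hg : ∀ k, planeFourier g k
      = parabolicSymbol k * (c * Complex.exp ((-(T * (k.1 ^ 4 + k.2 ^ 2)) : ℝ) : ℂ))) :
    (fun x => dampedKernel φ 0 s x - dampedKernel φ 0 (2 * s) x) =ᵐ[volume]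
      fun x => c⁻¹ * ∫ z, g z * ∫ r in Set.Ioc s (2 * s), dampedKernel φ T r (x - z) := by
  have hR : Integrable fun x => ∫ r in Set.Ioc s (2 * s), dampedKernel φ T r x :=
    (integrable_dampedKernel_prod φ.continuous φ.integrable hs hT).integral_prod_right
  have h1 := integrable_dampedKernel (T := 0) φ.integrable hs hs.le
  have h2 := integrable_dampedKernel (T := 0) φ.integrable (r := 2 * s) (by linarith) (by linarith)
  refine ae_eq_of_planeFourier_eq (h1.sub h2)
    ((integrable_plane_convolution g.integrable hR).const_mul _) fun k => ?_
  have hsym := symbol_mul_planeFourier_integral_dampedKernel φ.continuous φ.integrable hφ hs hT k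
  have hcc : (c : ℂ) ≠ 0 := by exact_mod_cast hc
  rw [planeFourier_sub h1 h2, planeFourier_const_mul, planeFourier_convolution g.integrable hR, hg,
    planeFourier_dampedKernel hφ hs hs.le,
    planeFourier_dampedKernel hφ (r := 2 * s) (by linarith) (by linarith)]
  have he : Complex.exp ((-(T * (k.1 ^ 4 + k.2 ^ 2)) : ℝ) : ℂ)
      * Complex.exp ((T * (k.1 ^ 4 + k.2 ^ 2) : ℝ) : ℂ) = 1 := by
    rw [← Complex.exp_add, ← Complex.ofReal_add, neg_add_cancel, Complex.ofReal_zero,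
      Complex.exp_zero]
  set P := planeFourier (fun x => ∫ r in Set.Ioc s (2 * s), dampedKernel φ T r x) k
  calc _ = Complex.exp (-(parabolicSymbol k : ℂ) * (s : ℂ))
          - Complex.exp (-(parabolicSymbol k : ℂ) * ((2 * s : ℝ) : ℂ)) := by simp
    _ = Complex.exp ((-(T * (k.1 ^ 4 + k.2 ^ 2)) : ℝ) : ℂ) * (parabolicSymbol k * P) := by
        rw [hsym, ← mul_assoc, he, one_mul]
    _ = _ := by
        push_cast
        field_simp

lemma integrable_convolution_mul_dampedKernel {φ g : SchwartzMap (ℝ × ℝ) ℝ} {f : ℝ × ℝ → ℝ}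
    (hf : Continuous f) {T s N : ℝ}
    (hN : ∀ z, |∫ y, f y * g (z - y)| ≤ N) (hs : 0 < s) (hT : T ≤ s) (x : ℝ × ℝ) :
    Integrable (fun p : ℝ × (ℝ × ℝ) => (∫ y, f y * g (p.2 - y)) * dampedKernel φ T p.1 (x - p.2))
      ((volume.restrict (Set.Ioc s (2 * s))).prod volume) := by
  have hGm : StronglyMeasurable fun z : ℝ × ℝ => ∫ y, f y * g (z - y) := by
    have hcont : Continuous fun p : (ℝ × ℝ) × (ℝ × ℝ) => f p.2 * g (p.1 - p.2) :=
      (hf.comp continuous_snd).mul (g.continuous.comp (by fun_prop))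
    exact hcont.stronglyMeasurable.integral_prod_right
  have hmp := (MeasurePreserving.id (volume.restrict (Set.Ioc s (2 * s)))).prod
    (Measure.measurePreserving_sub_left (volume : Measure (ℝ × ℝ)) x)
  have hI := hmp.integrable_comp_of_integrable
    (integrable_dampedKernel_prod φ.continuous φ.integrable hs hT)
  exact hI.bdd_mul (hGm.comp_measurable measurable_snd).aestronglyMeasurable
    (Filter.Eventually.of_forall fun p => hN p.2)

lemma convolution_dampedKernel_sub_eq {φ : SchwartzMap (ℝ × ℝ) ℝ}
    (hφ : ∀ k, planeFourier φ k = Complex.exp ((-(k.1 ^ 4 + k.2 ^ 2) : ℝ) : ℂ))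
    {f : ℝ × ℝ → ℝ} (hf : Continuous f) {B : ℝ} (hB : ∀ x, |f x| ≤ B)
    {g : SchwartzMap (ℝ × ℝ) ℝ} {c T s : ℝ}
    (hc : c ≠ 0) (hs : 0 < s) (hT : T ≤ s)
    (hg : ∀ k, planeFourier g k
      = parabolicSymbol k * (c * Complex.exp ((-(T * (k.1 ^ 4 + k.2 ^ 2)) : ℝ) : ℂ)))
    {N : ℝ}
    (hN : ∀ z, |∫ y, f y * g (z - y)| ≤ N) (x : ℝ × ℝ) :
    (∫ y, f y * dampedKernel φ 0 s (x - y)) - ∫ y, f y * dampedKernel φ 0 (2 * s) (x - y)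
      = c⁻¹ * ∫ r in Set.Ioc s (2 * s),
          ∫ z, (∫ y, f y * g (z - y)) * dampedKernel φ T r (x - z) := by
  have hR : Integrable fun x => ∫ r in Set.Ioc s (2 * s), dampedKernel φ T r x :=
    (integrable_dampedKernel_prod φ.continuous φ.integrable hs hT).integral_prod_right
  have h1 := integrable_dampedKernel (T := 0) φ.integrable hs hs.le
  have h2 := integrable_dampedKernel (T := 0) φ.integrable (r := 2 * s) (by linarith) (by linarith)
  have hae := (Measure.measurePreserving_sub_left (volume : Measure (ℝ × ℝ))
    x).quasiMeasurePreserving.ae_eq_comp (dampedKernel_sub_ae_eq hφ hc hs hT hg)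
  rw [integral_integral_swap (f := fun r z => (∫ y, f y * g (z - y)) * dampedKernel φ T r (x - z))
      (integrable_convolution_mul_dampedKernel hf hN hs hT x),
    ← integral_sub (integrable_bounded_mul hf.aestronglyMeasurable hB (h1.comp_sub_left x))
      (integrable_bounded_mul hf.aestronglyMeasurable hB (h2.comp_sub_left x))]
  simp only [integral_const_mul]
  rw [plane_convolution_assoc hf hB g.integrable hR, ← integral_const_mul]
  refine integral_congr_ae ?_
  filter_upwards [hae] with y hy
  simp only [Function.comp_apply] at hy
  rw [← mul_sub, hy]
  ring

lemma abs_convolution_dampedKernel_sub_le {φ : SchwartzMap (ℝ × ℝ) ℝ}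
    (hφ : ∀ k, planeFourier φ k = Complex.exp ((-(k.1 ^ 4 + k.2 ^ 2) : ℝ) : ℂ))
    {f : ℝ × ℝ → ℝ} (hf : Continuous f) {B : ℝ} (hB : ∀ x, |f x| ≤ B)
    {g : SchwartzMap (ℝ × ℝ) ℝ} {c T s : ℝ}
    (hc : c ≠ 0) (hs : 0 < s) (hT : T ≤ s)
    (hg : ∀ k, planeFourier g k
      = parabolicSymbol k * (c * Complex.exp ((-(T * (k.1 ^ 4 + k.2 ^ 2)) : ℝ) : ℂ)))
    {N : ℝ}
    (hN : ∀ z, |∫ y, f y * g (z - y)| ≤ N) (x : ℝ × ℝ) :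
    |(∫ y, f y * dampedKernel φ 0 s (x - y)) - ∫ y, f y * dampedKernel φ 0 (2 * s) (x - y)|
      ≤ |c|⁻¹ * (∫ x, |φ x|) * (N * (s * Real.exp (-s))) := by
  have hN0 : 0 ≤ N := (abs_nonneg _).trans (hN 0)
  rw [convolution_dampedKernel_sub_eq hφ hf hB hc hs hT hg hN, abs_mul, abs_inv, mul_assoc]
  refine mul_le_mul_of_nonneg_left ?_ (by positivity)
  have := norm_setIntegral_le_of_norm_le_const (μ := (volume : Measure ℝ))
    (s := Set.Ioc s (2 * s)) (C := N * (Real.exp (-s) * ∫ x, |φ x|))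
    (f := fun r => ∫ z, (∫ y, f y * g (z - y)) * dampedKernel φ T r (x - z)) (by simp)
    fun r hr => ?_
  · refine this.trans (le_of_eq ?_)
    rw [Real.volume_real_Ioc_of_le (by linarith)]
    ring
  · have hr0 : 0 < r := hs.trans hr.1
    have hTr : T ≤ r := hT.trans hr.1.le
    have hk := integrable_dampedKernel (T := T) φ.integrable hr0 hTr
    calc ‖∫ z, (∫ y, f y * g (z - y)) * dampedKernel φ T r (x - z)‖
        ≤ ∫ z, N * |dampedKernel φ T r (x - z)| := by
          refine norm_integral_le_of_norm_le ((hk.comp_sub_left x).abs.const_mul N)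
            (Filter.Eventually.of_forall fun z => ?_)
          rw [norm_mul]
          exact mul_le_mul_of_nonneg_right (hN z) (norm_nonneg _)
      _ = N * (Real.exp (-r) * ∫ x, |φ x|) := by
          rw [integral_const_mul, integral_sub_left_eq_self (fun z => |dampedKernel φ T r z|),
            integral_abs_dampedKernel φ hr0 hTr]
      _ ≤ _ := by
          have : 0 ≤ ∫ x, |φ x| := integral_nonneg fun x => abs_nonneg _
          have := hr.1.le
          gcongr

lemma abs_convolution_dampedKernel_sub_sub_le {φ : SchwartzMap (ℝ × ℝ) ℝ}
    (hφ : ∀ k, planeFourier φ k = Complex.exp ((-(k.1 ^ 4 + k.2 ^ 2) : ℝ) : ℂ))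
    {f : ℝ × ℝ → ℝ} (hf : Continuous f) {B : ℝ} (hB : ∀ x, |f x| ≤ B)
    {g : SchwartzMap (ℝ × ℝ) ℝ} {c T s : ℝ}
    (hc : c ≠ 0) (hs : 0 < s) (hT : T ≤ s)
    (hg : ∀ k, planeFourier g k
      = parabolicSymbol k * (c * Complex.exp ((-(T * (k.1 ^ 4 + k.2 ^ 2)) : ℝ) : ℂ)))
    {L : ℝ}
    (hL : ∀ h : ℝ × ℝ, ∫ x, |φ (x + h) - φ x| ≤ L * ‖h‖) {N : ℝ}
    (hN : ∀ z, |∫ y, f y * g (z - y)| ≤ N) (x y : ℝ × ℝ) :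
    |((∫ z, f z * dampedKernel φ 0 s (x - z)) - ∫ z, f z * dampedKernel φ 0 (2 * s) (x - z))
      - ((∫ z, f z * dampedKernel φ 0 s (y - z)) - ∫ z, f z * dampedKernel φ 0 (2 * s) (y - z))|
      ≤ |c|⁻¹ * L * (N * (s * Real.exp (-s)))
        * max (s ^ (-(1 / 4) : ℝ) * |x.1 - y.1|) (s ^ (-(1 / 2) : ℝ) * |x.2 - y.2|) := by
  have hN0 : 0 ≤ N := (abs_nonneg _).trans (hN 0)
  have hL0 : 0 ≤ L := by
    have := (integral_nonneg fun x => abs_nonneg (φ (x + (1, 1)) - φ x)).trans (hL (1, 1))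
    simpa [Prod.norm_def] using this
  have hI := fun x => integrable_convolution_mul_dampedKernel (φ := φ) hf hN hs hT x
  rw [convolution_dampedKernel_sub_eq hφ hf hB hc hs hT hg hN,
    convolution_dampedKernel_sub_eq hφ hf hB hc hs hT hg hN, ← mul_sub,
    ← integral_sub (hI x).integral_prod_left (hI y).integral_prod_left, abs_mul, abs_inv,
    mul_assoc, mul_assoc]
  refine mul_le_mul_of_nonneg_left ?_ (by positivity)
  set D := max (s ^ (-(1 / 4) : ℝ) * |x.1 - y.1|) (s ^ (-(1 / 2) : ℝ) * |x.2 - y.2|) with hD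
  have := norm_setIntegral_le_of_norm_le_const (μ := (volume : Measure ℝ))
    (s := Set.Ioc s (2 * s)) (C := N * (Real.exp (-s) * (L * D)))
    (f := fun r => (∫ z, (∫ y, f y * g (z - y)) * dampedKernel φ T r (x - z))
      - ∫ z, (∫ y, f y * g (z - y)) * dampedKernel φ T r (y - z)) (by simp)
    fun r hr => ?_
  · refine this.trans (le_of_eq ?_)
    rw [Real.volume_real_Ioc_of_le (by linarith)]
    ring
  · have hr0 : 0 < r := hs.trans hr.1
    have hTr : T ≤ r := hT.trans hr.1.le
    have hk := integrable_dampedKernel (T := T) φ.integrable hr0 hTr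
    have hGm : AEStronglyMeasurable fun z : ℝ × ℝ => ∫ y, f y * g (z - y) := by
      have hcont : Continuous fun p : (ℝ × ℝ) × (ℝ × ℝ) => f p.2 * g (p.1 - p.2) :=
        (hf.comp continuous_snd).mul (g.continuous.comp (by fun_prop))
      exact hcont.stronglyMeasurable.integral_prod_right.aestronglyMeasurable
    rw [← integral_sub (integrable_bounded_mul hGm hN (hk.comp_sub_left x))
      (integrable_bounded_mul hGm hN (hk.comp_sub_left y))]
    calc _ ≤ ∫ z, N * |dampedKernel φ T r (x - z) - dampedKernel φ T r (y - z)| := by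
          refine norm_integral_le_of_norm_le
            (((hk.comp_sub_left x).sub (hk.comp_sub_left y)).abs.const_mul N)
            (Filter.Eventually.of_forall fun z => ?_)
          rw [← mul_sub, norm_mul]
          exact mul_le_mul_of_nonneg_right (hN z) (norm_nonneg _)
      _ = N * ∫ z, |dampedKernel φ T r (z + (x - y)) - dampedKernel φ T r z| := by
          rw [integral_const_mul, ← integral_sub_left_eq_self (fun z =>
            |dampedKernel φ T r (z + (x - y)) - dampedKernel φ T r z|) volume y]
          simp only [show ∀ z, y - z + (x - y) = x - z from fun z => by abel]
      _ ≤ N * (Real.exp (-r) * (L * max (r ^ (-(1 / 4) : ℝ) * |(x - y).1|)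
            (r ^ (-(1 / 2) : ℝ) * |(x - y).2|))) :=
          mul_le_mul_of_nonneg_left (integral_abs_dampedKernel_sub_le hL hr0 hTr _) hN0
      _ ≤ N * (Real.exp (-s) * (L * D)) := by
          have hsr := hr.1.le
          have h4 : r ^ (-(1 / 4) : ℝ) ≤ s ^ (-(1 / 4) : ℝ) :=
            Real.rpow_le_rpow_of_nonpos hs hsr (by norm_num)
          have h2 : r ^ (-(1 / 2) : ℝ) ≤ s ^ (-(1 / 2) : ℝ) :=
            Real.rpow_le_rpow_of_nonpos hs hsr (by norm_num)
          rw [hD, Prod.fst_sub, Prod.snd_sub]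
          gcongr

lemma convolution_dampedKernel_eq (f φ : ℝ × ℝ → ℝ) {s : ℝ} (hs : 0 < s) (x : ℝ × ℝ) :
    ∫ y, f y * dampedKernel φ 0 s (x - y) = Real.exp (-s) *
      ∫ z : ℝ × ℝ, f (x.1 - ((2 * Real.pi) ^ 4 * s) ^ (1 / 4 : ℝ) * z.1,
        x.2 - ((2 * Real.pi) ^ 2 * s) ^ (1 / 2 : ℝ) * z.2) * φ z := by
  obtain ⟨ha, hb⟩ := two_pi_pow_mul_sub_pos hs hs.le
  rw [sub_zero] at ha hb
  rw [← integral_sub_left_eq_self (fun y => f y * dampedKernel φ 0 s (x - y)) volume x]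
  simp only [sub_sub_cancel, dampedKernel, sub_zero]
  simp only [mul_left_comm _ (Real.exp (-s)), integral_const_mul]
  rw [integral_mul_planeDilate ha hb (fun z => f (x - z))]
  simp only [Real.rpow_neg (show 0 ≤ (2 * Real.pi) ^ 4 * s by positivity),
    Real.rpow_neg (show 0 ≤ (2 * Real.pi) ^ 2 * s by positivity), inv_inv]
  rfl

lemma tendsto_convolution_dampedKernel_zero {f φ : ℝ × ℝ → ℝ} (hf : Continuous f) {B : ℝ}
    (hB : ∀ x, |f x| ≤ B) (hφ : Integrable φ) (hφ1 : ∫ x, φ x = 1) (x : ℝ × ℝ) :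
    Filter.Tendsto (fun s => ∫ y, f y * dampedKernel φ 0 s (x - y)) (nhdsWithin 0 (Set.Ioi 0))
      (nhds (f x)) := by
  have hkey : Filter.Tendsto (fun s : ℝ => Real.exp (-s) *
      ∫ z : ℝ × ℝ, f (x.1 - ((2 * Real.pi) ^ 4 * s) ^ (1 / 4 : ℝ) * z.1,
        x.2 - ((2 * Real.pi) ^ 2 * s) ^ (1 / 2 : ℝ) * z.2) * φ z) (nhdsWithin 0 (Set.Ioi 0))
      (nhds (Real.exp (-0) * ∫ z, f x * φ z)) := by
    refine Filter.Tendsto.mul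
      ((Continuous.tendsto (by fun_prop) _).mono_left nhdsWithin_le_nhds) ?_
    refine tendsto_integral_filter_of_dominated_convergence (fun z => B * |φ z|) ?_ ?_
      (hφ.abs.const_mul B) ?_
    · refine Filter.Eventually.of_forall fun s => AEStronglyMeasurable.mul ?_
        hφ.aestronglyMeasurable
      exact (hf.comp (by fun_prop)).aestronglyMeasurable
    · refine Filter.Eventually.of_forall fun s => Filter.Eventually.of_forall fun z => ?_
      rw [norm_mul]
      exact mul_le_mul_of_nonneg_right (hB _) (norm_nonneg _)
    · refine Filter.Eventually.of_forall fun z => ?_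
      have hc : Continuous fun s : ℝ => f (x.1 - ((2 * Real.pi) ^ 4 * s) ^ (1 / 4 : ℝ) * z.1,
          x.2 - ((2 * Real.pi) ^ 2 * s) ^ (1 / 2 : ℝ) * z.2) * φ z := by
        have h4 : Continuous fun s : ℝ => ((2 * Real.pi) ^ 4 * s) ^ (1 / 4 : ℝ) :=
          (continuous_const.mul continuous_id).rpow_const fun _ => Or.inr (by norm_num)
        have h2 : Continuous fun s : ℝ => ((2 * Real.pi) ^ 2 * s) ^ (1 / 2 : ℝ) :=
          (continuous_const.mul continuous_id).rpow_const fun _ => Or.inr (by norm_num)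
        fun_prop
      refine (hc.tendsto' 0 _ ?_).mono_left nhdsWithin_le_nhds
      simp
  rw [integral_const_mul, hφ1, neg_zero, Real.exp_zero, one_mul, mul_one] at hkey
  refine hkey.congr' ?_
  filter_upwards [self_mem_nhdsWithin] with s hs
  exact (convolution_dampedKernel_eq f φ hs x).symm

lemma tendsto_convolution_dampedKernel_atTop {f φ : ℝ × ℝ → ℝ} {B : ℝ}
    (hB : ∀ x, |f x| ≤ B) (hφ : Integrable φ) (x : ℝ × ℝ) :
    Filter.Tendsto (fun s => ∫ y, f y * dampedKernel φ 0 s (x - y)) Filter.atTop (nhds 0) := by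
  have h0 : Filter.Tendsto (fun s : ℝ => Real.exp (-s) * ∫ z, B * |φ z|) Filter.atTop (nhds 0) := by
    simpa using (Real.tendsto_exp_neg_atTop_nhds_zero).mul_const (∫ z, B * |φ z|)
  refine squeeze_zero_norm' ?_ h0
  filter_upwards [Filter.eventually_gt_atTop 0] with s hs
  rw [convolution_dampedKernel_eq f φ hs, norm_mul, Real.norm_eq_abs, Real.abs_exp]
  refine mul_le_mul_of_nonneg_left ?_ (Real.exp_nonneg _)
  refine norm_integral_le_of_norm_le (hφ.abs.const_mul B) (Filter.Eventually.of_forall fun z => ?_)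
  rw [norm_mul]
  exact mul_le_mul_of_nonneg_right (hB _) (norm_nonneg _)

lemma rpow_pow_four_mul_pow {d b : ℝ} (hd : 0 < d) (hb : 0 < b) (n : ℕ) (β : ℝ) :
    (d ^ 4 * b ^ n) ^ (β / 4) = d ^ β * (b ^ (β / 4)) ^ n := by
  rw [Real.mul_rpow (by positivity) (by positivity), ← Real.rpow_natCast_mul hd.le,
    ← Real.rpow_natCast_mul hb.le, ← Real.rpow_mul_natCast hb.le]
  congr 2
  · push_cast; ring
  · ring

/-- A dyadic telescoping argument: bounds on the dyadic increments of an approximation of `f`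
that are consistent with Hölder regularity `α` give a Hölder bound for `f`. -/
lemma abs_sub_le_of_dyadic_increments {F : ℝ → ℝ × ℝ → ℝ} {f : ℝ × ℝ → ℝ} {α A A' : ℝ}
    (hα : 0 < α) (hα1 : α < 1) (hA : 0 ≤ A) (hA' : 0 ≤ A')
    (h_zero : ∀ x, Filter.Tendsto (F · x) (nhdsWithin 0 (Set.Ioi 0)) (nhds (f x)))
    (h_top : ∀ x, Filter.Tendsto (F · x) Filter.atTop (nhds 0))
    (h_inc : ∀ s, 0 < s → ∀ x, |F s x - F (2 * s) x| ≤ A * s ^ (α / 4))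
    (h_diff : ∀ s, 0 < s → ∀ x y, |(F s x - F (2 * s) x) - (F s y - F (2 * s) y)|
      ≤ A' * s ^ (α / 4)
        * max (s ^ (-(1 / 4) : ℝ) * |x.1 - y.1|) (s ^ (-(1 / 2) : ℝ) * |x.2 - y.2|))
    (x y : ℝ × ℝ) {d : ℝ} (hd : 0 < d) (h1 : |x.1 - y.1| ≤ d) (h2 : |x.2 - y.2| ≤ d ^ 2) :
    |f x - f y| ≤ (2 * (A / (1 - (1 / 2 : ℝ) ^ (α / 4))) + A' / (1 - (2 : ℝ) ^ ((α - 1) / 4)))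
      * d ^ α := by
  have hq : (1 / 2 : ℝ) ^ (α / 4) < 1 :=
    Real.rpow_lt_one (by norm_num) (by norm_num) (by linarith)
  have hq' : (2 : ℝ) ^ ((α - 1) / 4) < 1 :=
    Real.rpow_lt_one_of_one_lt_of_neg (by norm_num) (by linarith)
  have low : ∀ z, |F (d ^ 4) z - f z| ≤ A * d ^ α / (1 - (1 / 2 : ℝ) ^ (α / 4)) := fun z => by
    have hlim : Filter.Tendsto (fun n : ℕ => F (d ^ 4 * (1 / 2) ^ n) z) Filter.atTop
        (nhds (f z)) := by
      refine (h_zero z).comp (tendsto_nhdsWithin_iff.2 ⟨?_, Filter.Eventually.of_forall fun n =>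
        Set.mem_Ioi.2 (by positivity)⟩)
      simpa using (tendsto_pow_atTop_nhds_zero_of_lt_one (r := (1 / 2 : ℝ)) (by norm_num)
        (by norm_num)).const_mul (d ^ 4)
    have := dist_le_of_le_geometric_of_tendsto₀ ((1 / 2 : ℝ) ^ (α / 4)) (A * d ^ α) hq
      (f := fun n : ℕ => F (d ^ 4 * (1 / 2) ^ n) z) (fun n => ?_) hlim
    · simpa [Real.dist_eq] using this
    · rw [dist_comm, Real.dist_eq]
      have hs : 0 < d ^ 4 * (1 / 2 : ℝ) ^ (n + 1) := by positivity
      have h := h_inc _ hs z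
      rw [show 2 * (d ^ 4 * (1 / 2 : ℝ) ^ (n + 1)) = d ^ 4 * (1 / 2) ^ n by ring] at h
      refine h.trans ?_
      rw [mul_assoc]
      refine mul_le_mul_of_nonneg_left ?_ hA
      calc (d ^ 4 * (1 / 2 : ℝ) ^ (n + 1)) ^ (α / 4)
          ≤ (d ^ 4 * (1 / 2 : ℝ) ^ n) ^ (α / 4) := by
            refine Real.rpow_le_rpow hs.le ?_ (by linarith)
            exact mul_le_mul_of_nonneg_left
              (pow_le_pow_of_le_one (by norm_num) (by norm_num) (Nat.le_succ n)) (by positivity)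
        _ = d ^ α * ((1 / 2 : ℝ) ^ (α / 4)) ^ n := rpow_pow_four_mul_pow hd (by norm_num) n α
  have high : |F (d ^ 4) x - F (d ^ 4) y| ≤ A' * d ^ α / (1 - (2 : ℝ) ^ ((α - 1) / 4)) := by
    have hlim : Filter.Tendsto (fun n : ℕ => F (d ^ 4 * 2 ^ n) x - F (d ^ 4 * 2 ^ n) y)
        Filter.atTop (nhds (0 - 0)) := by
      have : Filter.Tendsto (fun n : ℕ => d ^ 4 * (2 : ℝ) ^ n) Filter.atTop Filter.atTop :=
        (tendsto_pow_atTop_atTop_of_one_lt (by norm_num)).const_mul_atTop (by positivity)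
      exact ((h_top x).comp this).sub ((h_top y).comp this)
    have := dist_le_of_le_geometric_of_tendsto₀ ((2 : ℝ) ^ ((α - 1) / 4)) (A' * d ^ α) hq'
      (f := fun n : ℕ => F (d ^ 4 * 2 ^ n) x - F (d ^ 4 * 2 ^ n) y) (fun n => ?_) hlim
    · simpa [Real.dist_eq] using this
    · have hs : 0 < d ^ 4 * (2 : ℝ) ^ n := by positivity
      have h := h_diff _ hs x y
      rw [show 2 * (d ^ 4 * (2 : ℝ) ^ n) = d ^ 4 * 2 ^ (n + 1) by ring] at h
      rw [Real.dist_eq, sub_sub_sub_comm]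
      refine h.trans ?_
      rw [mul_assoc, mul_assoc]
      refine mul_le_mul_of_nonneg_left ?_ hA'
      set s := d ^ 4 * (2 : ℝ) ^ n with hsdef
      have hsd : s ^ (-(1 / 4) : ℝ) * d ≤ 1 := by
        have : d ≤ s ^ (1 / 4 : ℝ) := by
          calc d = (d ^ 4) ^ (1 / 4 : ℝ) := by
                rw [← Real.rpow_natCast_mul hd.le]; norm_num
            _ ≤ s ^ (1 / 4 : ℝ) := by
                refine Real.rpow_le_rpow (by positivity) ?_ (by norm_num)
                exact le_mul_of_one_le_right (by positivity) (one_le_pow₀ (by norm_num))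
        rw [Real.rpow_neg hs.le, inv_mul_le_one₀ (by positivity)]
        exact this
      have hmax : max (s ^ (-(1 / 4) : ℝ) * |x.1 - y.1|) (s ^ (-(1 / 2) : ℝ) * |x.2 - y.2|)
          ≤ s ^ (-(1 / 4) : ℝ) * d := by
        refine max_le (by gcongr) ?_
        calc s ^ (-(1 / 2) : ℝ) * |x.2 - y.2| ≤ s ^ (-(1 / 2) : ℝ) * d ^ 2 := by gcongr
          _ = (s ^ (-(1 / 4) : ℝ) * d) ^ 2 := by
            rw [mul_pow, ← Real.rpow_mul_natCast hs.le]; norm_num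
          _ ≤ s ^ (-(1 / 4) : ℝ) * d := pow_le_of_le_one (by positivity) hsd (by norm_num)
      calc s ^ (α / 4) * _ ≤ s ^ (α / 4) * (s ^ (-(1 / 4) : ℝ) * d) := by gcongr
        _ = s ^ ((α - 1) / 4) * d := by
            rw [← mul_assoc, ← Real.rpow_add hs]; congr 2; ring
        _ = d ^ α * ((2 : ℝ) ^ ((α - 1) / 4)) ^ n := by
            rw [hsdef, rpow_pow_four_mul_pow hd (by norm_num), Real.rpow_sub_one hd.ne']
            field_simp
  have hx := low x
  have hy := low y
  calc |f x - f y| = |(F (d ^ 4) x - F (d ^ 4) y) - (F (d ^ 4) x - f x)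
        + (F (d ^ 4) y - f y)| := by congr 1; ring
    _ ≤ |F (d ^ 4) x - F (d ^ 4) y| + |F (d ^ 4) x - f x| + |F (d ^ 4) y - f y| :=
        (abs_add_le _ _).trans (by gcongr; exact abs_sub _ _)
    _ ≤ _ := (add_le_add (add_le_add high hx) hy).trans (le_of_eq (by ring))

lemma ne_zero_of_planeFourier_eq_const_mul {g : ℝ × ℝ → ℝ} (hg : Integrable g)
    (hg1 : ∫ x, |g x| = 1) {C : ℝ} {u : ℝ × ℝ → ℂ} (h : ∀ k, planeFourier g k = C * u k) :
    C ≠ 0 := by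
  rintro rfl
  have h0 : g =ᵐ[volume] fun _ => 0 :=
    ae_eq_of_planeFourier_eq hg (integrable_zero _ _ _) fun k => by
      rw [h k]; simp [planeFourier]
  have : ∫ x, |g x| = 0 := by
    rw [integral_congr_ae (g := fun _ => 0) (h0.mono fun x hx => by simp [hx]), integral_zero]
  norm_num [this] at hg1

lemma mul_exp_neg_le_one (s : ℝ) : s * Real.exp (-s) ≤ 1 := by
  rw [Real.exp_neg, ← div_eq_mul_inv, div_le_one (Real.exp_pos s)]
  linarith [Real.add_one_le_exp s]

/-- A bound for `T ≤ 1` at the rate `T ^ (β - 1)` gives, after damping, a bound at all scales. -/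
lemma exists_bound_damped {G : ℝ → ℝ × ℝ → ℝ} {K β : ℝ} (hβ : 0 ≤ β)
    (hG : ∀ T, 0 < T → T ≤ 1 → ∀ x, T * |G T x| ≤ K * T ^ β) {s : ℝ} (hs : 0 < s) :
    ∃ N, (∀ x, |G (min s 1) x| ≤ N) ∧ N * (s * Real.exp (-s)) ≤ K * s ^ β := by
  have hK : 0 ≤ K := by
    have := hG 1 one_pos le_rfl 0
    rw [one_mul, Real.one_rpow, mul_one] at this
    exact (abs_nonneg _).trans this
  rcases le_total s 1 with h | h
  · rw [min_eq_left h]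
    refine ⟨K * s ^ β / s, fun x => (le_div_iff₀' hs).2 (hG s hs h x), ?_⟩
    rw [← mul_assoc, div_mul_cancel₀ _ hs.ne']
    exact mul_le_of_le_one_right (by positivity) (Real.exp_le_one_iff.2 (by linarith))
  · rw [min_eq_right h]
    refine ⟨K, fun x => by simpa using hG 1 one_pos le_rfl x, ?_⟩
    exact mul_le_mul_of_nonneg_left
      ((mul_exp_neg_le_one s).trans (Real.one_le_rpow h hβ)) hK

/-- a Hölder seminorm bound in terms of the semigroup of
`𝓐 = ∂₁⁴ - ∂₂² + 1` (step 1 of the proof of the equivalence of norms). -/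
theorem holder_seminorm_from_semigroup
    (ψ : ℝ → ℝ × ℝ → ℝ) (hψ : IsPsiKernel ψ)
    (α : ℝ) (hα : 0 < α) (hα1 : α < 1) :
    ∃ C : ℝ, ∀ f : ℝ × ℝ → ℝ, Continuous f → (∃ B : ℝ, ∀ x : ℝ × ℝ, |f x| ≤ B) →
      ∀ K : ℝ,
        (∀ T : ℝ, 0 < T → T ≤ 1 → ∀ x : ℝ × ℝ,
          T * |(pd1^[4] (fun z : ℝ × ℝ => ∫ y : ℝ × ℝ, f y * ψ T (z - y))) x
                - pd2 (pd2 (fun z : ℝ × ℝ => ∫ y : ℝ × ℝ, f y * ψ T (z - y))) x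
                + (∫ y : ℝ × ℝ, f y * ψ T (x - y))|
            ≤ K * T ^ (α / 4)) →
        ∀ x y : ℝ × ℝ, |f x - f y| ≤ C * K * pdist x y ^ α := by
  obtain ⟨hS, ⟨c, hFψ⟩, h1⟩ := hψ
  obtain ⟨φ₁, hφ₁⟩ := hS 1 one_pos
  have hc : c ≠ 0 := by
    rw [hφ₁] at h1
    exact ne_zero_of_planeFourier_eq_const_mul φ₁.integrable h1 fun k =>
      hφ₁ ▸ hFψ 1 one_pos k
  have hcc : (c : ℂ) ≠ 0 := by exact_mod_cast hc
  set φ : SchwartzMap (ℝ × ℝ) ℝ := c⁻¹ • φ₁ with hφdef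
  have hφ : ∀ k, planeFourier φ k = Complex.exp ((-(k.1 ^ 4 + k.2 ^ 2) : ℝ) : ℂ) := fun k => by
    have h : planeFourier φ₁ k = c * Complex.exp ((-(1 * (k.1 ^ 4 + k.2 ^ 2)) : ℝ) : ℂ) :=
      hφ₁ ▸ hFψ 1 one_pos k
    change planeFourier (fun x => c⁻¹ * φ₁ x) k = _
    rw [planeFourier_const_mul, h, one_mul, Complex.ofReal_inv, inv_mul_cancel_left₀ hcc]
  have hφint : ∫ x, φ x = 1 := by
    have h := hφ 0
    simp only [planeFourier, planeChar, Prod.fst_zero, Prod.snd_zero, zero_mul, add_zero, mul_zero,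
      neg_zero, Complex.ofReal_zero, Complex.exp_zero, one_mul, ne_eq, OfNat.ofNat_ne_zero,
      not_false_eq_true, zero_pow] at h
    rw [integral_complex_ofReal] at h
    exact_mod_cast h
  obtain ⟨L, hL⟩ := φ.exists_integral_translate_sub_le
  have hL0 : 0 ≤ L := by
    have := (integral_nonneg fun x => abs_nonneg (φ (x + (1, 1)) - φ x)).trans (hL (1, 1))
    simpa [Prod.norm_def] using this
  have hI0 : 0 ≤ ∫ x, |φ x| := integral_nonneg fun x => abs_nonneg _
  refine ⟨2 * (|c|⁻¹ * (∫ x, |φ x|) / (1 - (1 / 2 : ℝ) ^ (α / 4)))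
    + |c|⁻¹ * L / (1 - (2 : ℝ) ^ ((α - 1) / 4)), fun f hf ⟨B, hB⟩ K hK x y => ?_⟩
  have hscale : ∀ s, 0 < s → ∃ g : SchwartzMap (ℝ × ℝ) ℝ, ∃ N,
      (∀ k, planeFourier g k = parabolicSymbol k *
        (c * Complex.exp ((-(min s 1 * (k.1 ^ 4 + k.2 ^ 2)) : ℝ) : ℂ))) ∧
      (∀ z, |∫ y, f y * g (z - y)| ≤ N) ∧ N * (s * Real.exp (-s)) ≤ K * s ^ (α / 4) := by
    intro s hs
    obtain ⟨N, hN, hNs⟩ := exists_bound_damped (by linarith) hK hs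
    have hT : 0 < min s 1 := lt_min hs one_pos
    obtain ⟨φ_T, hφ_T⟩ := hS _ hT
    refine ⟨parabolicOp φ_T, N, fun k => ?_, fun z => ?_, hNs⟩
    · rw [planeFourier_parabolicOp, ← hφ_T]
      exact congrArg _ (hFψ _ hT k)
    · rw [← parabolicOp_convolution hf hB, ← hφ_T]
      exact hN z
  have hK0 : 0 ≤ K := by
    have := hK 1 one_pos le_rfl 0
    rw [one_mul, Real.one_rpow, mul_one] at this
    exact (abs_nonneg _).trans this
  have hx1 : |x.1 - y.1| ≤ pdist x y := le_add_of_nonneg_right (Real.sqrt_nonneg _)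
  have hx2 : |x.2 - y.2| ≤ pdist x y ^ 2 := by
    rw [← Real.sqrt_le_left (by unfold pdist; positivity)]
    exact le_add_of_nonneg_left (abs_nonneg _)
  rcases (show 0 ≤ pdist x y by unfold pdist; positivity).eq_or_lt with hd | hd
  · rw [← hd, Real.zero_rpow hα.ne', mul_zero]
    rw [← hd] at hx1 hx2
    have hxy : x = y := Prod.ext (sub_eq_zero.1 (abs_nonpos_iff.1 hx1))
      (sub_eq_zero.1 (abs_nonpos_iff.1 (by simpa using hx2)))
    simp [hxy]
  refine (abs_sub_le_of_dyadic_increments (A := |c|⁻¹ * (∫ x, |φ x|) * K) (A' := |c|⁻¹ * L * K)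
    (F := fun s x => ∫ y, f y * dampedKernel φ 0 s (x - y)) hα hα1 (by positivity)
    (by positivity) (tendsto_convolution_dampedKernel_zero hf hB φ.integrable hφint)
    (tendsto_convolution_dampedKernel_atTop hB φ.integrable) (fun s hs z => ?_)
    (fun s hs z w => ?_) x y hd hx1 hx2).trans (le_of_eq (by ring))
  · obtain ⟨g, N, hg, hN, hNs⟩ := hscale s hs
    refine (abs_convolution_dampedKernel_sub_le hφ hf hB hc hs (min_le_left _ _) hg hN z).trans ?_
    rw [mul_assoc (_ * _)]
    exact mul_le_mul_of_nonneg_left hNs (by positivity)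
  · obtain ⟨g, N, hg, hN, hNs⟩ := hscale s hs
    refine (abs_convolution_dampedKernel_sub_sub_le hφ hf hB hc hs (min_le_left _ _) hg hL hN
      z w).trans (mul_le_mul_of_nonneg_right ?_ ?_)
    · rw [mul_assoc (_ * _)]
      exact mul_le_mul_of_nonneg_left hNs (by positivity)
    · exact le_max_of_le_left (by positivity)
end
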